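/- arXiv:2310.01091 — 3 statements merged into one kernel-verified Lean document; each statement's English description precedes it below -/
import Mathlib

section
/- For a rational integer angle with vertex at the origin, the broken line formed by the vertices of its sail is a vortex broken line about the origin, and every edge of the sail lies at integer distance 1 from the origin. Consequently, the sail diagram of any locally convex broken line or polygon with integer vertices is a vortex broken line about the origin all of whose edges lie at integer distance 1 from the origin. -/
open scoped BigOperators

/-- Integer points of the plane. -/
abbrev Pt := ℤ × ℤ

/-- Determinant of two integer vectors. -/
def vdet (u v : Pt) : ℤ := u.1 * v.2 - u.2 * v.1

/-- Integer length of the segment `PQ`. -/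
def il (P Q : Pt) : ℤ := Int.gcd (Q.1 - P.1) (Q.2 - P.2)

/-- Integer distance from the point `P` to the line through `S` and `T`. -/
def idist (P S T : Pt) : ℤ := |vdet (T - S) (P - S)| / il S T

/-- The primitive integer vector in the direction from `P` to `Q`. -/
def primVec (P Q : Pt) : Pt := ((Q.1 - P.1) / il P Q, (Q.2 - P.2) / il P Q)

/-- `Q` lies on the ray emanating from `V` through `X`. -/
def OnRay (V X Q : Pt) : Prop := ∃ s t : ℤ, 0 < s ∧ 0 < t ∧ s • (Q - V) = t • (X - V)

/-- `P` lies in the convex angle with vertex `V` and edge rays towards `X` and `Y`. -/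
def InAngle (X V Y P : Pt) : Prop :=
  ∃ q s t : ℤ, 0 < q ∧ 0 ≤ s ∧ 0 ≤ t ∧ q • (P - V) = s • (X - V) + t • (Y - V)

/-- An affine lattice-preserving transformation of `ℤ²` (an element of Aff(2,ℤ)). -/
structure IntAff where
  a : ℤ
  b : ℤ
  c : ℤ
  d : ℤ
  u : ℤ
  v : ℤ
  unimod : a * d - b * c = 1 ∨ a * d - b * c = -1

/-- Action of an element of Aff(2,ℤ) on an integer point. -/
def IntAff.apply (T : IntAff) (P : Pt) : Pt :=
  (T.a * P.1 + T.b * P.2 + T.u, T.c * P.1 + T.d * P.2 + T.v)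

/-- Integer congruence of the angles ∠XVY and ∠X'V'Y' (vertices `V`, `V'`). -/
def AngleCong (X V Y X' V' Y' : Pt) : Prop :=
  ∃ T : IntAff, T.apply V = V' ∧ OnRay V' X' (T.apply X) ∧ OnRay V' Y' (T.apply Y)

/-- Auxiliary function: continuant of the reversed list. -/
def contRev : List ℤ → ℤ
  | [] => 1
  | [x] => x
  | x :: y :: l => x * contRev (y :: l) + contRev l

/-- The continuant `K`: `K(ε)=1`, `K(x₁)=x₁`,
`K(x₁,…,xₙ)=xₙK(x₁,…,x_{n−1})+K(x₁,…,x_{n−2})`. -/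
def cont (l : List ℤ) : ℤ := contRev l.reverse

/-- A list is a valid LLS sequence of a rational integer angle:
odd length and positive entries. -/
def ValidLLS (l : List ℤ) : Prop := l.length % 2 = 1 ∧ ∀ x ∈ l, 0 < x

/-- The second edge point of the standard angle ∠(a₀,…,a₂ₘ):
the point `(K(a₁,…,a₂ₘ), K(a₀,…,a₂ₘ))`. -/
def stdPt (l : List ℤ) : Pt := (cont l.tail, cont l)

/-- The angle ∠XVY (vertex `V`) is a rational angle with LLS sequence `l`;
equivalently it is integer congruent to the standard angle
∠((1,0),(0,0),(K(a₁,…,a₂ₘ),K(a₀,…,a₂ₘ))) of the list. -/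
def IsLLSOfAngle (X V Y : Pt) (l : List ℤ) : Prop :=
  ValidLLS l ∧ AngleCong ((1, 0) : Pt) ((0, 0) : Pt) (stdPt l) X V Y

open Classical in
/-- Direction comparison sign `sgn⟨u,w⟩`: `1` if `w` has the same direction as `u`,
`0` if `w = 0`, and `-1` otherwise. -/
noncomputable def sgnDir (u w : Pt) : ℤ :=
  if w = ((0 : ℤ), (0 : ℤ)) then 0
  else if ∃ s t : ℤ, 0 < s ∧ 0 < t ∧ s • w = t • u then 1 else -1

/-- `P` is the integer point of the angle ∠XVY at integer distance 1 from the
line `VY` which is closest to the line `XV`. -/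
def IsNearPt (X V Y P : Pt) : Prop :=
  InAngle X V Y P ∧ idist P V Y = 1 ∧
  ∀ Q : Pt, InAngle X V Y Q → idist Q V Y = 1 → idist P X V ≤ idist Q X V

/-- `k` is the chord curvature of the locally convex broken line `ABCD`. -/
def IsChordCurv (A B C D : Pt) (k : ℤ) : Prop :=
  ∃ B' C' : Pt, IsNearPt A B C B' ∧ IsNearPt D C B C' ∧
    k = il B C - sgnDir (C - B) (C' - B') * il B' C' - 2

/-- `A` lists the vertices of a convex polygon (in convex position, ordered so that
all interior angles are positively oriented). -/
def ConvexPolygon (n : ℕ) (A : ZMod n → Pt) : Prop :=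
  ∀ i j : ZMod n, j ≠ i → j ≠ i + 1 → vdet (A (i + 1) - A i) (A j - A i) < 0

/-- A closed broken line (polygon) all of whose angles have the same orientation. -/
def LocallyConvexPolygon (n : ℕ) (A : ZMod n → Pt) : Prop :=
  (∀ i : ZMod n, 0 < vdet (A (i - 1) - A i) (A (i + 1) - A i)) ∨
  (∀ i : ZMod n, vdet (A (i - 1) - A i) (A (i + 1) - A i) < 0)

/-- A locally convex closed polygon with positively oriented angles. -/
def PosLocConvexPolygon (n : ℕ) (A : ZMod n → Pt) : Prop :=
  ∀ i : ZMod n, 0 < vdet (A (i - 1) - A i) (A (i + 1) - A i)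

/-- A locally convex broken line `A 0 … A (n+1)` (angles at vertices `1,…,n`). -/
def LocallyConvexBL (n : ℕ) (A : ℕ → Pt) : Prop :=
  (∀ i, 1 ≤ i → i ≤ n → 0 < vdet (A (i - 1) - A i) (A (i + 1) - A i)) ∨
  (∀ i, 1 ≤ i → i ≤ n → vdet (A (i - 1) - A i) (A (i + 1) - A i) < 0)

/-- A locally convex broken line with positively oriented angles. -/
def PosLocConvexBL (n : ℕ) (A : ℕ → Pt) : Prop :=
  ∀ i, 1 ≤ i → i ≤ n → 0 < vdet (A (i - 1) - A i) (A (i + 1) - A i)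

/-- The polygon `A` (with `n` vertices) has angle-curvature sequence
`(L 0, κ 0, …, L (n-1), κ (n-1))` (0-indexed). -/
def HasACS (n : ℕ) (A : ZMod n → Pt) (L : ℕ → List ℤ) (κ : ℕ → ℤ) : Prop :=
  ∀ i : ℕ, i < n →
    IsLLSOfAngle (A ((i : ZMod n) - 1)) (A (i : ZMod n)) (A ((i : ZMod n) + 1)) (L i) ∧
    IsChordCurv (A ((i : ZMod n) - 1)) (A (i : ZMod n)) (A ((i : ZMod n) + 1))
      (A ((i : ZMod n) + 2)) (κ i)

/-- `llsCat L κ j m = lls(S_j^{j+m})`, the concatenation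
`lls(α_j) ∘ (κ_j) ∘ ⋯ ∘ (κ_{j+m-1}) ∘ lls(α_{j+m})` (0-indexed angles). -/
def llsCat (L : ℕ → List ℤ) (κ : ℕ → ℤ) (j : ℕ) : ℕ → List ℤ
  | 0 => L j
  | m + 1 => llsCat L κ j m ++ (κ (j + m) :: L (j + m + 1))

/-- Number of consecutive opposite-sign pairs. -/
def altCount : List ℤ → ℕ
  | x :: y :: l => (if x * y < 0 then 1 else 0) + altCount (y :: l)
  | _ => 0

/-- Number of sign changes of an integer sequence: after removing all zero
elements, the number of pairs of consecutive elements with opposite signs. -/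
def signChanges (l : List ℤ) : ℕ := altCount (l.filter (fun x => x != 0))

/-- Coercion of an integer point to the real plane. -/
noncomputable def toR (P : Pt) : ℝ × ℝ := ((P.1 : ℝ), (P.2 : ℝ))

/-- The integer points of the angle ∠XVY distinct from the vertex. -/
def conePts (X V Y : Pt) : Set Pt := {P | InAngle X V Y P ∧ P ≠ V}

/-- `P` is a vertex of the sail of the angle ∠XVY: an integer point of the
angle (other than the vertex) which is a vertex of the convex hull of all
such points. -/
def SailVertex (X V Y P : Pt) : Prop :=
  P ∈ conePts X V Y ∧ toR P ∉ convexHull ℝ (toR '' (conePts X V Y \ {P}))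

/-- `B 0, …, B m` is the broken line formed by the vertices of the sail of the
angle ∠XVY, ordered from the edge `VX` to the edge `VY`. -/
def IsSailBL (X V Y : Pt) (m : ℕ) (B : ℕ → Pt) : Prop :=
  (∀ i ≤ m, SailVertex X V Y (B i)) ∧
  (∀ P, SailVertex X V Y P → ∃ i ≤ m, B i = P) ∧
  (∀ i ≤ m, ∀ j ≤ m, B i = B j → i = j) ∧
  OnRay V X (B 0) ∧ OnRay V Y (B m) ∧
  (∀ i < m, vdet (B (i + 1) - B i) (V - B i) ≠ 0 ∧
    ∀ P, SailVertex X V Y P →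
      vdet (B (i + 1) - B i) (V - B i) * vdet (B (i + 1) - B i) (P - B i) ≤ 0)

/-- Sign alternation used in sail diagrams (`1` on the first angle). -/
def sgnAlt (i : ℕ) : ℤ := if i % 2 = 0 then 1 else -1

/-- `D` is the sail diagram of the polygon `A` with the decomposition data
`m` (numbers of sail edges), `c` (offsets) and `B` (sails of the angles):
the concatenation of the sails of the consecutive angles translated to the
origin, composed with the central symmetry for alternate angles. -/
def IsSailDiagramAux (n : ℕ) (A : ZMod n → Pt) (m c : ℕ → ℕ) (B : ℕ → ℕ → Pt)
    (D : ℕ → Pt) : Prop :=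
  c 0 = 0 ∧ (∀ i, c (i + 1) = c i + m i) ∧
  ∀ i < n,
    IsSailBL (A ((i : ZMod n) - 1)) (A (i : ZMod n)) (A ((i : ZMod n) + 1)) (m i) (B i) ∧
    ∀ j ≤ m i, D (c i + j) = sgnAlt i • (B i j - A (i : ZMod n))

/-- `D 0 … D M` is the sail diagram of the polygon `A`. -/
def IsSailDiagram (n : ℕ) (A : ZMod n → Pt) (M : ℕ) (D : ℕ → Pt) : Prop :=
  ∃ m c B, IsSailDiagramAux n A m c B D ∧ M = c n

/-- `D 0 … D M` is the sail diagram of the broken line `A 0 … A (n+1)`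
(whose angles are at the vertices `1,…,n`). -/
def IsSailDiagramBL (n : ℕ) (A : ℕ → Pt) (M : ℕ) (D : ℕ → Pt) : Prop :=
  ∃ (m c : ℕ → ℕ) (B : ℕ → ℕ → Pt),
    c 1 = 0 ∧ (∀ i, c (i + 1) = c i + m i) ∧ M = c (n + 1) ∧
    ∀ i, 1 ≤ i → i ≤ n →
      IsSailBL (A (i - 1)) (A i) (A (i + 1)) (m i) (B i) ∧
      ∀ j ≤ m i, D (c i + j) = sgnAlt (i + 1) • (B i j - A i)

/-- Euclidean angular measure of the angle between the vectors `u` and `v`. -/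
noncomputable def angMeasure (u v : Pt) : ℝ :=
  Real.arccos (((u.1 * v.1 + u.2 * v.2 : ℤ) : ℝ) /
    (Real.sqrt ((u.1 : ℝ) ^ 2 + (u.2 : ℝ) ^ 2) * Real.sqrt ((v.1 : ℝ) ^ 2 + (v.2 : ℝ) ^ 2)))

/-- Winding number of the broken line `D 0 … D M` about the origin. -/
noncomputable def winding (M : ℕ) (D : ℕ → Pt) : ℝ :=
  (∑ i ∈ Finset.range M, angMeasure (D i) (D (i + 1))) / (2 * Real.pi)

/-- The segment `(b st, b (st+1), …, b (st+len-1))` of a sequence as a list. -/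
def bseg (b : ℕ → ℤ) (st len : ℕ) : List ℤ := (List.range len).map fun t => b (st + t)

/-- The edge vertex `Bᵢ` of a normalized sail diagram, via continuants:
`(K(b₁,…,b_{2s}), K(b₀,…,b_{2s}))` where `s = s(i)`. -/
def BiPt (b : ℕ → ℤ) (s : ℕ) : Pt := (cont (bseg b 1 (2 * s)), cont (bseg b 0 (2 * s + 1)))

/-- The integer point `Bᵢ⁺` following `Bᵢ`:
`(K(b₁,…,b_{2s},b_{2s+1},1), K(b₀,…,b_{2s},b_{2s+1},1))`. -/
def BpPt (b : ℕ → ℤ) (s : ℕ) : Pt :=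
  (cont (bseg b 1 (2 * s) ++ [b (2 * s + 1), 1]),
   cont (bseg b 0 (2 * s + 1) ++ [b (2 * s + 1), 1]))

/-- The integer point `Bᵢ⁻` preceding `Bᵢ`:
`(K(b₁,…,b_{2s}−1), K(b₀,…,b_{2s}−1))`. -/
def BmPt (b : ℕ → ℤ) (s : ℕ) : Pt :=
  (cont (bseg b 1 (2 * s - 1) ++ [b (2 * s) - 1]),
   cont (bseg b 0 (2 * s) ++ [b (2 * s) - 1]))

/-- The point `B̂ᵢ = (K(b₁,…,b_{2s},0,1), K(b₀,…,b_{2s},0,1))`. -/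
def hatBPt (b : ℕ → ℤ) (s : ℕ) : Pt :=
  (cont (bseg b 1 (2 * s) ++ [0, 1]), cont (bseg b 0 (2 * s + 1) ++ [0, 1]))

lemma aux_inAngle_iff {X V Y : Pt} (hD : 0 < vdet (X - V) (Y - V)) (P : Pt) :
    InAngle X V Y P ↔ 0 ≤ vdet (X - V) (P - V) ∧ 0 ≤ vdet (P - V) (Y - V) := by
  constructor
  · rintro ⟨q, s, t, hq, hs, ht, h⟩
    have h1 := congrArg Prod.fst h
    have h2 := congrArg Prod.snd h
    simp at h1 h2
    simp only [vdet, Prod.fst_sub, Prod.snd_sub] at hD ⊢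
    constructor
    · refine nonneg_of_mul_nonneg_right (a := q) ?_ hq
      have := mul_nonneg ht hD.le
      linear_combination this - (X.1 - V.1) * h2 + (X.2 - V.2) * h1
    · refine nonneg_of_mul_nonneg_right (a := q) ?_ hq
      have := mul_nonneg hs hD.le
      linear_combination this + (Y.1 - V.1) * h2 - (Y.2 - V.2) * h1
  · rintro ⟨h1, h2⟩
    refine ⟨_, _, _, hD, h2, h1, ?_⟩
    ext <;> simp [vdet] <;> ring

lemma aux_middle {X V Y P Q R : Pt} (hP : SailVertex X V Y P) (hQ : Q ∈ conePts X V Y)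
    (hR : R ∈ conePts X V Y) (hQP : Q ≠ P) (hRP : R ≠ P) (a b : ℤ) (ha : 0 < a) (hb : 0 < b)
    (h1 : (a + b) * P.1 = a * Q.1 + b * R.1) (h2 : (a + b) * P.2 = a * Q.2 + b * R.2) : False := by
  apply hP.2
  have cQ : toR Q ∈ convexHull ℝ (toR '' (conePts X V Y \ {P})) :=
    subset_convexHull ℝ _ ⟨Q, ⟨hQ, hQP⟩, rfl⟩
  have cR : toR R ∈ convexHull ℝ (toR '' (conePts X V Y \ {P})) :=
    subset_convexHull ℝ _ ⟨R, ⟨hR, hRP⟩, rfl⟩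
  have ha' : (0 : ℝ) < a := by exact_mod_cast ha
  have hb' : (0 : ℝ) < b := by exact_mod_cast hb
  have h1' : ((a : ℝ) + b) * P.1 = a * Q.1 + b * R.1 := by exact_mod_cast h1
  have h2' : ((a : ℝ) + b) * P.2 = a * Q.2 + b * R.2 := by exact_mod_cast h2
  have hc := (convex_convexHull ℝ (toR '' (conePts X V Y \ {P}))) cQ cR
    (a := (a : ℝ) / (a + b)) (b := (b : ℝ) / (a + b)) (by positivity) (by positivity)
    (by field_simp)
  convert hc using 1
  ext
  · simp [toR]; field_simp; linarith
  · simp [toR]; field_simp; linarith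

lemma aux_extreme {X V Y P : Pt} (hP : P ∈ conePts X V Y) (k l : ℤ)
    (h : ∀ Q ∈ conePts X V Y, Q ≠ P → k * P.1 + l * P.2 < k * Q.1 + l * Q.2) :
    SailVertex X V Y P := by
  refine ⟨hP, fun hc => ?_⟩
  have hconv : Convex ℝ {z : ℝ × ℝ | (k : ℝ) * P.1 + l * P.2 < k * z.1 + l * z.2} := by
    apply convex_halfSpace_gt
    constructor
    · intro x y; simp; ring
    · intro c x; simp; ring
  have hsub : convexHull ℝ (toR '' (conePts X V Y \ {P})) ⊆
      {z : ℝ × ℝ | (k : ℝ) * P.1 + l * P.2 < k * z.1 + l * z.2} := by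
    apply convexHull_min _ hconv
    rintro _ ⟨Q, ⟨hQ, hQP⟩, rfl⟩
    have := h Q hQ hQP
    simp only [toR, Set.mem_ofPred_eq]
    exact_mod_cast this
  have := hsub hc
  simp [toR] at this

lemma aux_min {X V Y : Pt} (hD : 0 < vdet (X - V) (Y - V)) (e : Pt)
    (hX : 0 < vdet (X - V) e) (hY : 0 < vdet (Y - V) e) (P : Pt) (hP : P ∈ conePts X V Y) :
    ∃ Q, SailVertex X V Y Q ∧ vdet (Q - V) e ≤ vdet (P - V) e := by
  have hpos : ∀ Q ∈ conePts X V Y, 0 < vdet (Q - V) e := by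
    rintro Q ⟨⟨q, s, t, hq, hs, ht, h⟩, hne⟩
    have h1 := congrArg Prod.fst h
    have h2 := congrArg Prod.snd h
    simp at h1 h2
    have key : q * vdet (Q - V) e = s * vdet (X - V) e + t * vdet (Y - V) e := by
      simp [vdet]
      linear_combination e.2 * h1 - e.1 * h2
    refine (mul_pos_iff_of_pos_left hq).1 ?_
    rcases hs.lt_or_eq with hs' | hs'
    · rw [key]; nlinarith [mul_pos hs' hX, mul_nonneg ht hY.le]
    · rcases ht.lt_or_eq with ht' | ht'
      · rw [key]; nlinarith [mul_pos ht' hY, mul_nonneg hs hX.le]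
      · exfalso
        apply hne
        subst hs' ht'
        simp at h1 h2
        ext
        · rcases h1 with h1 | h1 <;> omega
        · rcases h2 with h2 | h2 <;> omega
  obtain ⟨P0, hP0, hmin0⟩ := (measure (fun Q : Pt => (vdet (Q - V) e).toNat)).wf.has_min
    (conePts X V Y) ⟨P, hP⟩
  obtain ⟨P1, ⟨hP1, hP1e⟩, hmin1⟩ :=
    (measure (fun Q : Pt => (vdet (X - V) (Q - V)).toNat)).wf.has_min
    {Q | Q ∈ conePts X V Y ∧ vdet (Q - V) e = vdet (P0 - V) e} ⟨P0, hP0, rfl⟩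
  have hf : ∀ Q ∈ conePts X V Y, vdet (P1 - V) e ≤ vdet (Q - V) e := by
    intro Q hQ
    have h1 := hmin0 Q hQ
    have h2 := hpos Q hQ
    have h3 := hpos P0 hP0
    simp [WellFoundedRelation.rel, InvImage] at h1
    omega
  have hg : ∀ Q ∈ conePts X V Y, vdet (Q - V) e = vdet (P1 - V) e →
      vdet (X - V) (P1 - V) ≤ vdet (X - V) (Q - V) := by
    intro Q hQ hQe
    have h1 := hmin1 Q ⟨hQ, hQe.trans hP1e⟩
    have h2 := ((aux_inAngle_iff hD Q).1 hQ.1).1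
    have h3 := ((aux_inAngle_iff hD P1).1 hP1.1).1
    simp [WellFoundedRelation.rel, InvImage] at h1
    omega
  refine ⟨P1, ?_, hf P hP⟩
  have g0 := ((aux_inAngle_iff hD P1).1 hP1.1).1
  set N := vdet (X - V) (P1 - V) + 1 with hN
  have main : ∀ Q ∈ conePts X V Y, Q ≠ P1 →
      N * vdet (P1 - V) e + vdet (X - V) (P1 - V) < N * vdet (Q - V) e + vdet (X - V) (Q - V) := by
    intro Q hQ hne
    rcases (hf Q hQ).lt_or_eq with hlt | heq
    · have := ((aux_inAngle_iff hD Q).1 hQ.1).1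
      nlinarith
    · rcases (hg Q hQ heq.symm).lt_or_eq with hlt' | heq'
      · rw [heq]; omega
      · exfalso
        apply hne
        simp only [vdet, Prod.fst_sub, Prod.snd_sub] at heq heq' hX
        have hX' := hX.ne'
        ext
        · apply mul_left_cancel₀ hX'
          linear_combination (-(X.1 - V.1)) * heq + (-e.1) * heq'
        · apply mul_left_cancel₀ hX'
          linear_combination (-(X.2 - V.2)) * heq + (-e.2) * heq'
  apply aux_extreme hP1 (N * e.2 - (X.2 - V.2)) (-N * e.1 + (X.1 - V.1))
  intro Q hQ hne
  have := main Q hQ hne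
  simp [vdet] at this
  clear_value N
  simp [vdet] at hN
  linear_combination this

lemma aux_pos {X V Y : Pt} {m : ℕ} {B : ℕ → Pt} (hD : 0 < vdet (X - V) (Y - V))
    (hB : IsSailBL X V Y m B) : ∀ i < m, 0 < vdet (B i - V) (B (i + 1) - V) := by
  obtain ⟨hv, _, hinj, h0, _, hedge⟩ := hB
  have hrew : ∀ a b : Pt, vdet (b - a) (V - a) = vdet (a - V) (b - V) := by
    intro a b; simp [vdet]; ring
  intro i
  induction i with
  | zero =>
    intro hm
    have hne := (hedge 0 hm).1
    rw [hrew] at hne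
    have hc := ((aux_inAngle_iff hD _).1 (hv 1 hm).1.1).1
    obtain ⟨s, t, hs, ht, h⟩ := h0
    have h1 := congrArg Prod.fst h
    have h2 := congrArg Prod.snd h
    simp at h1 h2
    have key : s * vdet (B 0 - V) (B 1 - V) = t * vdet (X - V) (B 1 - V) := by
      simp [vdet]
      linear_combination ((B 1).2 - V.2) * h1 - ((B 1).1 - V.1) * h2
    have : 0 ≤ vdet (B 0 - V) (B 1 - V) := by
      refine nonneg_of_mul_nonneg_right (a := s) ?_ hs
      rw [key]; positivity
    simp only [zero_add] at hne ⊢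
    omega
  | succ i ih =>
    intro hm
    have hpos := ih (by omega)
    by_contra hneg
    have e1 := hedge i (by omega)
    have e2 := hedge (i + 1) hm
    have va := hv i (by omega)
    have vb := hv (i + 1) (by omega)
    have vc := hv (i + 1 + 1) (by omega)
    have nab : B i ≠ B (i + 1) := fun h => by have := hinj _ (by omega) _ (by omega) h; omega
    have nac : B i ≠ B (i + 1 + 1) := fun h => by have := hinj _ (by omega) _ (by omega) h; omega
    have nbc : B (i + 1) ≠ B (i + 1 + 1) := fun h => by
      have := hinj _ (by omega) _ (by omega) h; omega
    rw [hrew] at e1 e2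
    have f1 := e1.2 _ vc
    have f2 := e2.2 _ va
    have n2 := e2.1
    generalize B i = a at *
    generalize B (i + 1) = b at *
    generalize B (i + 1 + 1) = c at *
    have hneg' : vdet (b - V) (c - V) < 0 := by omega
    have g1 : vdet (b - a) (c - a) ≤ 0 := by
      by_contra h; push Not at h; nlinarith [mul_pos hpos h]
    have g2 : 0 ≤ vdet (c - b) (a - b) := by
      by_contra h; push Not at h; nlinarith [mul_pos_of_neg_of_neg hneg' h]
    have s1 : vdet (b - a) (c - a) = vdet (c - b) (a - b) := by simp [vdet]; ring
    have hz : vdet (a - V) (b - V) + vdet (b - V) (c - V) - vdet (a - V) (c - V) = 0 := by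
      have : vdet (a - V) (b - V) + vdet (b - V) (c - V) - vdet (a - V) (c - V)
        = vdet (b - a) (c - a) := by simp [vdet]; ring
      omega
    set u := vdet (a - V) (b - V) with hu
    set v := vdet (b - V) (c - V) with hvv
    set w := vdet (a - V) (c - V) with hw
    clear_value u v w
    have r1 : u * (c.1 - V.1) = w * (b.1 - V.1) - v * (a.1 - V.1) := by
      rw [hu, hvv, hw]; simp [vdet]; ring
    have r2 : u * (c.2 - V.2) = w * (b.2 - V.2) - v * (a.2 - V.2) := by
      rw [hu, hvv, hw]; simp [vdet]; ring
    have hwe : w = u + v := by omega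
    subst hwe
    rcases lt_trichotomy (u + v) 0 with hw0 | hw0 | hw0
    · refine aux_middle va vc.1 vb.1 nac.symm nab.symm u (-(u + v)) hpos (by omega) ?_ ?_
      · linear_combination -r1
      · linear_combination -r2
    · apply nac
      have : v = -u := by omega
      subst this
      ext
      · apply mul_left_cancel₀ hpos.ne'
        linear_combination -r1
      · apply mul_left_cancel₀ hpos.ne'
        linear_combination -r2
    · refine aux_middle vc va.1 vb.1 nac nbc (-v) (u + v) (by omega) hw0 ?_ ?_
      · linear_combination r1
      · linear_combination r2

lemma aux_dist {X V Y : Pt} {m : ℕ} {B : ℕ → Pt} (hD : 0 < vdet (X - V) (Y - V))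
    (hB : IsSailBL X V Y m B) (i : ℕ) (hi : i < m) :
    idist ((0, 0) : Pt) (B i - V) (B (i + 1) - V) = 1 := by
  have hc := aux_pos hD hB i hi
  obtain ⟨hv, _, hinj, h0, hm, hedge⟩ := hB
  have hrew : ∀ a b : Pt, vdet (b - a) (V - a) = vdet (a - V) (b - V) := by
    intro a b; simp [vdet]; ring
  have hsup := (hedge i hi).2
  rw [hrew] at hsup
  have vb := hv i hi.le
  have vb' := hv (i + 1) hi
  have v0 := hv 0 (by omega)
  have vm := hv m le_rfl
  generalize B i = b at *
  generalize B (i + 1) = b' at *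
  generalize B 0 = b0 at *
  generalize B m = bm at *
  -- support for vertices
  have hS : ∀ P, SailVertex X V Y P → vdet (b - V) (b' - V) ≤ vdet (P - V) (b' - b) := by
    intro P hP
    have h1 := hsup P hP
    have h2 : vdet (b' - b) (P - b) ≤ 0 := by
      by_contra h; push Not at h; nlinarith [mul_pos hc h]
    have h3 : vdet (P - V) (b' - b) - vdet (b - V) (b' - V) = - vdet (b' - b) (P - b) := by
      simp [vdet]; ring
    omega
  have hray : ∀ Z P : Pt, OnRay V Z P → 0 < vdet (P - V) (b' - b) → 0 < vdet (Z - V) (b' - b) := by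
    rintro Z P ⟨s, t, hs, ht, h⟩ hp
    have h1 := congrArg Prod.fst h
    have h2 := congrArg Prod.snd h
    simp at h1 h2
    have key : s * vdet (P - V) (b' - b) = t * vdet (Z - V) (b' - b) := by
      simp [vdet]
      linear_combination (b'.2 - b.2) * h1 - (b'.1 - b.1) * h2
    refine (mul_pos_iff_of_pos_left ht).1 ?_
    rw [← key]; positivity
  have hX := hray _ _ h0 (lt_of_lt_of_le hc (hS _ v0))
  have hY := hray _ _ hm (lt_of_lt_of_le hc (hS _ vm))
  -- support for all cone points, as vectors
  have hall : ∀ p : Pt, 0 ≤ vdet (X - V) p → 0 ≤ vdet p (Y - V) → p ≠ 0 →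
      vdet (b - V) (b' - V) ≤ vdet p (b' - b) := by
    intro p h1 h2 hp
    have hmem : p + V ∈ conePts X V Y := by
      refine ⟨(aux_inAngle_iff hD _).2 ?_, ?_⟩
      · simpa using ⟨h1, h2⟩
      · simpa using hp
    obtain ⟨Q, hQ, hle⟩ := aux_min hD _ hX hY _ hmem
    have := hS Q hQ
    simp only [add_sub_cancel_right] at hle
    exact this.trans hle
  have cb := (aux_inAngle_iff hD _).1 vb.1.1
  have cb' := (aux_inAngle_iff hD _).1 vb'.1.1
  have e1 : b' - b = (b' - V) - (b - V) := by simp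
  rw [e1] at hall
  generalize b - V = r at *
  generalize b' - V = r' at *
  generalize X - V = x at *
  generalize Y - V = y at *
  clear hS hray hX hY hsup hrew hedge hinj hv h0 hm vb vb' v0 vm e1
  -- primitive vector
  have hgpos : 0 < Int.gcd (r'.1 - r.1) (r'.2 - r.2) := by
    rw [Int.gcd_pos_iff]
    by_contra h
    push Not at h
    have : r' = r := by ext <;> [have := h.1; have := h.2] <;> omega
    subst this
    simp [vdet, mul_comm] at hc
  obtain ⟨e, f, hcop, he, hf⟩ := Int.exists_gcd_one hgpos
  set g : ℤ := (Int.gcd (r'.1 - r.1) (r'.2 - r.2) : ℤ) with hg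
  have hg0 : 0 < g := by rw [hg]; exact_mod_cast hgpos
  have hbez := Int.gcd_eq_gcd_ab e f
  rw [hcop] at hbez
  generalize Int.gcdA e f = α at hbez
  generalize Int.gcdB e f = β at hbez
  have hilr : il r r' = g := rfl
  have hr1 : r'.1 = r.1 + g * e := by linarith
  have hr2 : r'.2 = r.2 + g * f := by linarith
  clear_value g
  set d : ℤ := r.1 * f - r.2 * e with hd
  have hvd : vdet r r' = g * d := by simp only [vdet, hr1, hr2, hd]; ring
  have hd0 : 0 < d := by
    rw [hvd] at hc
    exact (mul_pos_iff_of_pos_left hg0).1 hc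
  have hid : idist ((0, 0) : Pt) r r' = d := by
    have : vdet (r' - r) ((0, 0) - r) = g * d := by
      rw [← hvd]; simp [vdet]; ring
    rw [idist, this, hilr, abs_of_pos (by positivity), Int.mul_ediv_cancel_left _ hg0.ne']
  rw [hid]
  by_contra hd1
  have hd2 : 2 ≤ d := by omega
  -- general criterion: d p = s r + t (r + e), with level in (0,d)
  have crit : ∀ (p : Pt) (s t : ℤ), 0 ≤ s → 0 ≤ t → d * p.1 = s * r.1 + t * (r.1 + e) →
      d * p.2 = s * r.2 + t * (r.2 + f) → 0 < p.1 * f - p.2 * e → p.1 * f - p.2 * e < d →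
      False := by
    intro p s t hs ht q1 q2 l1 l2
    have p0 : p ≠ 0 := by rintro rfl; simp at l1
    have k := hall p ?_ ?_ p0
    · rw [hvd] at k
      have : vdet p (r' - r) = g * (p.1 * f - p.2 * e) := by
        simp [vdet, hr1, hr2]; ring
      rw [this] at k
      nlinarith
    · refine nonneg_of_mul_nonneg_right (a := d * g) ?_ (by positivity)
      have w1 : d * g * vdet x p = (g * s + (g - 1) * t) * vdet x r + t * vdet x r' := by
        simp only [vdet, hr1, hr2]
        linear_combination (g * x.1) * q2 - (g * x.2) * q1
      rw [w1]
      have := cb.1; have := cb'.1; have : 0 ≤ g - 1 := by omega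
      positivity
    · refine nonneg_of_mul_nonneg_right (a := d * g) ?_ (by positivity)
      have w1 : d * g * vdet p y = (g * s + (g - 1) * t) * vdet r y + t * vdet r' y := by
        simp only [vdet, hr1, hr2]
        linear_combination (g * y.2) * q1 - (g * y.1) * q2
      rw [w1]
      have := cb.2; have := cb'.2; have : 0 ≤ g - 1 := by omega
      positivity
  -- w = (β, -α): w.1 f - w.2 e = 1
  have hb1 : e * α + f * β = 1 := by simpa using hbez.symm
  set j0 : ℤ := r.1 * (-α) - r.2 * β with hj0
  set k : ℤ := -(j0 / d) with hk
  set j : ℤ := j0 % d with hj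
  have hjk : j = j0 + k * d := by
    have := Int.emod_add_mul_ediv j0 d
    rw [hj, hk]; linarith
  have hj1 : 0 ≤ j := Int.emod_nonneg _ hd0.ne'
  have hj2 : j < d := Int.emod_lt_of_pos _ hd0
  clear_value k j
  have P1 : d * (β + k * e) = r.1 + j * e := by
    rw [hjk, hj0, hd]; linear_combination r.1 * hb1
  have P2 : d * (-α + k * f) = r.2 + j * f := by
    rw [hjk, hj0, hd]; linear_combination r.2 * hb1
  have L : (β + k * e) * f - (-α + k * f) * e = 1 := by linear_combination hb1
  by_cases hj3 : j ≤ 1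
  · refine crit (β + k * e, -α + k * f) (1 - j) j (by omega) hj1 ?_ ?_ ?_ ?_
    · simp only; linear_combination P1
    · simp only; linear_combination P2
    · simp only; omega
    · simp only; omega
  · have L2 : (r.1 + e - (β + k * e)) * f - (r.2 + f - (-α + k * f)) * e = d - 1 := by
      rw [hd]; linear_combination -L
    refine crit (r.1 + e - (β + k * e), r.2 + f - (-α + k * f)) (j - 1) (d - j)
      (by omega) (by omega) ?_ ?_ ?_ ?_
    · simp only; linear_combination -P1
    · simp only; linear_combination -P2
    · simp only; omega
    · simp only; omega

lemma aux_sgn (i : ℕ) : sgnAlt i = 1 ∨ sgnAlt i = -1 := by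
  unfold sgnAlt; split_ifs <;> simp

lemma aux_smul {σ : ℤ} (hσ : σ = 1 ∨ σ = -1) {u v : Pt}
    (h : 0 < vdet u v ∧ idist ((0, 0) : Pt) u v = 1) :
    0 < vdet (σ • u) (σ • v) ∧ idist ((0, 0) : Pt) (σ • u) (σ • v) = 1 := by
  rcases hσ with rfl | rfl
  · simpa using h
  · have h1 : vdet ((-1 : ℤ) • u) ((-1 : ℤ) • v) = vdet u v := by simp [vdet]
    refine ⟨by rw [h1]; exact h.1, ?_⟩
    refine Eq.trans ?_ h.2
    unfold idist
    have h2 : vdet ((-1 : ℤ) • v - (-1 : ℤ) • u) ((0, 0) - (-1 : ℤ) • u)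
        = vdet (v - u) ((0, 0) - u) := by simp [vdet]; ring
    have h3 : il ((-1 : ℤ) • u) ((-1 : ℤ) • v) = il u v := by
      have a1 : -v.1 - -u.1 = -(v.1 - u.1) := by ring
      have a2 : -v.2 - -u.2 = -(v.2 - u.2) := by ring
      simp only [il, neg_smul, one_smul, a1, a2, Prod.fst_neg,
        Prod.snd_neg, Int.gcd_neg, Int.neg_gcd]
    rw [h2, h3]

lemma aux_find (c m : ℕ → ℕ) (s : ℕ) (h0 : c s = 0) (hc : ∀ i, c (i + 1) = c i + m i) (n i : ℕ)
    (hi : i < c (s + n)) : ∃ k j, s ≤ k ∧ k < s + n ∧ j < m k ∧ i = c k + j := by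
  induction n with
  | zero => simp [h0] at hi
  | succ n ih =>
    by_cases h : i < c (s + n)
    · obtain ⟨k, j, h1, h2, h3, h4⟩ := ih h
      exact ⟨k, j, h1, by omega, h3, h4⟩
    · have := hc (s + n)
      rw [← add_assoc] at hi
      exact ⟨s + n, i - c (s + n), by omega, by omega, by omega, by omega⟩

/-- **Proposition.** For a rational integer angle with vertex at the origin, the
broken line formed by the vertices of its sail is a vortex broken line about the
origin, with all its edges at integer distance 1 from the origin. Consequently,
the sail diagram of any (positively oriented) locally convex broken line or
polygon with integer vertices is a vortex broken line about the origin all of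
whose edges lie at integer distance 1 from the origin. -/
theorem sail_and_sail_diagram_vortex :
    (∀ (X Y : Pt) (m : ℕ) (B : ℕ → Pt),
        0 < vdet X Y → IsSailBL X ((0, 0) : Pt) Y m B →
        (∀ i < m, 0 < vdet (B i) (B (i + 1))) ∧
        (∀ i < m, idist ((0, 0) : Pt) (B i) (B (i + 1)) = 1)) ∧
    (∀ (n : ℕ) (A : ℕ → Pt) (M : ℕ) (D : ℕ → Pt),
        1 ≤ n → PosLocConvexBL n A → IsSailDiagramBL n A M D →
        (∀ i < M, 0 < vdet (D i) (D (i + 1))) ∧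
        (∀ i < M, idist ((0, 0) : Pt) (D i) (D (i + 1)) = 1)) ∧
    (∀ (n : ℕ) (A : ZMod n → Pt) (M : ℕ) (D : ℕ → Pt),
        3 ≤ n → PosLocConvexPolygon n A → IsSailDiagram n A M D →
        (∀ i < M, 0 < vdet (D i) (D (i + 1))) ∧
        (∀ i < M, idist ((0, 0) : Pt) (D i) (D (i + 1)) = 1)) := by
  have core : ∀ (X V Y : Pt) (m : ℕ) (B : ℕ → Pt), 0 < vdet (X - V) (Y - V) →
      IsSailBL X V Y m B → ∀ i < m, 0 < vdet (B i - V) (B (i + 1) - V) ∧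
      idist ((0, 0) : Pt) (B i - V) (B (i + 1) - V) = 1 :=
    fun X V Y m B hD hB i hi => ⟨aux_pos hD hB i hi, aux_dist hD hB i hi⟩
  refine ⟨?_, ?_, ?_⟩
  · intro X Y m B hD hB
    have hz : ∀ P : Pt, P - ((0, 0) : Pt) = P := fun P => sub_zero P
    have := core X (0, 0) Y m B (by rwa [hz, hz]) hB
    simp only [hz] at this
    exact ⟨fun i hi => (this i hi).1, fun i hi => (this i hi).2⟩
  · intro n A M D hn hA ⟨m, c, B, h1, hc, hM, h⟩
    have key : ∀ i < M, 0 < vdet (D i) (D (i + 1)) ∧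
        idist ((0, 0) : Pt) (D i) (D (i + 1)) = 1 := by
      intro i hi
      rw [hM, add_comm] at hi
      obtain ⟨k, j, hk1, hk2, hj, rfl⟩ := aux_find c m 1 h1 hc n i hi
      obtain ⟨hB, hDj⟩ := h k hk1 (by omega)
      rw [add_assoc, hDj j hj.le, hDj (j + 1) hj]
      exact aux_smul (aux_sgn _) (core _ _ _ _ _ (hA k hk1 (by omega)) hB j hj)
    exact ⟨fun i hi => (key i hi).1, fun i hi => (key i hi).2⟩
  · intro n A M D hn hA ⟨m, c, B, ⟨h1, hc, h⟩, hM⟩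
    have key : ∀ i < M, 0 < vdet (D i) (D (i + 1)) ∧
        idist ((0, 0) : Pt) (D i) (D (i + 1)) = 1 := by
      intro i hi
      rw [hM, ← zero_add n] at hi
      obtain ⟨k, j, hk1, hk2, hj, rfl⟩ := aux_find c m 0 h1 hc n i hi
      obtain ⟨hB, hDj⟩ := h k (by omega)
      rw [add_assoc, hDj j hj.le, hDj (j + 1) hj]
      exact aux_smul (aux_sgn _) (core _ _ _ _ _ (hA k) hB j hj)
    exact ⟨fun i hi => (key i hi).1, fun i hi => (key i hi).2⟩
end

section
/- The winding number about the origin of the sail diagram of a convex n-gon with integer vertices equals n/2 − 1. -/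
open scoped BigOperators

/-- complex number of an integer point -/
noncomputable def cxP (p : Pt) : ℂ := ⟨(p.1 : ℝ), (p.2 : ℝ)⟩

/-- signed angle -/
noncomputable def angP (p q : Pt) : ℝ := (cxP q / cxP p).arg

lemma cxP_ne {p : Pt} (h : p ≠ 0) : cxP p ≠ 0 := by
  intro h0
  apply h
  have h1 := congrArg Complex.re h0
  have h2 := congrArg Complex.im h0
  simp [cxP] at h1 h2
  exact Prod.ext h1 h2

lemma cxP_im (p q : Pt) : (cxP q / cxP p).im = (vdet p q : ℝ) / Complex.normSq (cxP p) := by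
  rw [Complex.div_im]
  simp only [cxP, vdet]
  push_cast
  ring

lemma cxP_re (p q : Pt) : (cxP q / cxP p).re =
    ((p.1 * q.1 + p.2 * q.2 : ℤ) : ℝ) / Complex.normSq (cxP p) := by
  rw [Complex.div_re]
  simp only [cxP]
  push_cast
  ring

lemma cxP_norm (p : Pt) : ‖cxP p‖ = Real.sqrt ((p.1 : ℝ) ^ 2 + (p.2 : ℝ) ^ 2) := by
  rw [Complex.norm_def, Complex.normSq_apply]
  simp only [cxP, sq]

lemma vdet_ne_left {p q : Pt} (h : 0 < vdet p q) : p ≠ 0 := by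
  rintro rfl
  simp [vdet] at h

lemma vdet_ne_right {p q : Pt} (h : 0 < vdet p q) : q ≠ 0 := by
  rintro rfl
  simp [vdet] at h

lemma angP_nonneg {p q : Pt} (h : 0 ≤ vdet p q) : 0 ≤ angP p q := by
  unfold angP
  rw [Complex.arg_nonneg_iff, cxP_im]
  have : (0 : ℝ) ≤ vdet p q := by exact_mod_cast h
  exact div_nonneg this (Complex.normSq_nonneg _)

lemma angP_le_pi (p q : Pt) : angP p q ≤ Real.pi := Complex.arg_le_pi _

lemma angP_im_pos {p q : Pt} (h : 0 < vdet p q) : 0 < (cxP q / cxP p).im := by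
  rw [cxP_im]
  have : (0 : ℝ) < vdet p q := by exact_mod_cast h
  exact div_pos this (Complex.normSq_pos.2 (cxP_ne (vdet_ne_left h)))

lemma angP_lt_pi {p q : Pt} (h : 0 < vdet p q) : angP p q < Real.pi := by
  unfold angP
  rw [Complex.arg_lt_pi_iff]
  exact Or.inr (angP_im_pos h).ne'

lemma angP_coe {p q : Pt} (hp : p ≠ 0) (hq : q ≠ 0) :
    (angP p q : Real.Angle) = (cxP q).arg - (cxP p).arg :=
  Complex.arg_div_coe_angle (cxP_ne hq) (cxP_ne hp)

lemma angP_self {p : Pt} (hp : p ≠ 0) : angP p p = 0 := by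
  unfold angP
  rw [div_self (cxP_ne hp), Complex.arg_one]

lemma angP_add {p q r : Pt} (hp : p ≠ 0) (hq : q ≠ 0) (hr : r ≠ 0) (h1 : 0 ≤ vdet p q)
    (h2 : 0 ≤ vdet q r) (h3 : 0 ≤ vdet p r) (h : 0 < vdet p q ∨ 0 < vdet q r) :
    angP p r = angP p q + angP q r := by
  have e : ((angP p q + angP q r : ℝ) : Real.Angle) = (angP p r : ℝ) := by
    rw [Real.Angle.coe_add, angP_coe hp hq, angP_coe hq hr, angP_coe hp hr]
    abel
  obtain ⟨k, hk⟩ := Real.Angle.angle_eq_iff_two_pi_dvd_sub.1 e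
  have a1 := angP_nonneg h1
  have a2 := angP_nonneg h2
  have a3 := angP_nonneg h3
  have b1 := angP_le_pi p q
  have b2 := angP_le_pi q r
  have b3 := angP_le_pi p r
  have hs : angP p q + angP q r < 2 * Real.pi := by
    rcases h with h | h
    · have := angP_lt_pi h
      linarith
    · have := angP_lt_pi h
      linarith
  have hpi := Real.pi_pos
  have k1 : (k : ℝ) < 1 := by
    by_contra hc
    push Not at hc
    nlinarith
  have k2 : (-1 : ℝ) < k := by
    by_contra hc
    push Not at hc
    nlinarith
  have k1' : k < 1 := by exact_mod_cast k1
  have k2' : -1 < k := by exact_mod_cast k2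
  have : k = 0 := by omega
  subst this
  simp at hk
  linarith

lemma cxP_neg (p : Pt) : cxP (-p) = - cxP p := by
  apply Complex.ext <;> simp [cxP]

lemma angP_tri {P Q R : Pt} (h : 0 < vdet (Q - P) (R - P)) :
    angP (Q - P) (R - P) + angP (R - Q) (P - Q) + angP (P - R) (Q - R) = Real.pi := by
  have h2 : 0 < vdet (R - Q) (P - Q) := by
    simp only [vdet, Prod.fst_sub, Prod.snd_sub] at h ⊢
    linarith
  have h3 : 0 < vdet (P - R) (Q - R) := by
    simp only [vdet, Prod.fst_sub, Prod.snd_sub] at h ⊢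
    linarith
  have neg : ∀ {p : Pt}, p ≠ 0 → ((cxP (-p)).arg : Real.Angle) = (cxP p).arg + Real.pi := by
    intro p hp
    rw [cxP_neg, Complex.arg_neg_coe_angle (cxP_ne hp)]
  have e : ((angP (Q - P) (R - P) + angP (R - Q) (P - Q) + angP (P - R) (Q - R) : ℝ) :
      Real.Angle) = (Real.pi : ℝ) := by
    rw [Real.Angle.coe_add, Real.Angle.coe_add, angP_coe (vdet_ne_left h) (vdet_ne_right h),
      angP_coe (vdet_ne_left h2) (vdet_ne_right h2), angP_coe (vdet_ne_left h3) (vdet_ne_right h3)]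
    rw [← neg_sub Q P, ← neg_sub R Q, ← neg_sub P R, neg (vdet_ne_left h), neg (vdet_ne_left h2),
      neg (vdet_ne_left h3)]
    have : ((Real.pi : ℝ) : Real.Angle) + (Real.pi : ℝ) = 0 := by
      rw [← Real.Angle.coe_add, ← two_mul, Real.Angle.coe_two_pi]
    have h3 : ((Real.pi : ℝ) : Real.Angle) + (Real.pi : ℝ) + (Real.pi : ℝ) = (Real.pi : ℝ) := by
      rw [this, zero_add]
    refine Eq.trans ?_ h3
    abel
  obtain ⟨k, hk⟩ := Real.Angle.angle_eq_iff_two_pi_dvd_sub.1 e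
  have a1 := angP_nonneg h.le
  have a2 := angP_nonneg h2.le
  have a3 := angP_nonneg h3.le
  have b1 := angP_lt_pi h
  have b2 := angP_lt_pi h2
  have b3 := angP_lt_pi h3
  have hpi := Real.pi_pos
  have k1 : (k : ℝ) < 1 := by
    by_contra hc
    push Not at hc
    nlinarith
  have k2 : (-1 : ℝ) < k := by
    by_contra hc
    push Not at hc
    nlinarith
  have k1' : k < 1 := by exact_mod_cast k1
  have k2' : -1 < k := by exact_mod_cast k2
  have : k = 0 := by omega
  subst this
  simp at hk
  linarith

lemma angP_ray {p q q' : Pt} {s t : ℤ} (hs : 0 < s) (ht : 0 < t) (h : s • q = t • q') :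
    angP p q = angP p q' := by
  have hs' : (0 : ℝ) < s := by exact_mod_cast hs
  have ht' : (0 : ℝ) < t := by exact_mod_cast ht
  have e : ((s : ℝ) : ℂ) * cxP q = ((t : ℝ) : ℂ) * cxP q' := by
    have h1 := congrArg Prod.fst h
    have h2 := congrArg Prod.snd h
    simp at h1 h2
    apply Complex.ext
    · simp [cxP]; exact_mod_cast h1
    · simp [cxP]; exact_mod_cast h2
  unfold angP
  rw [← Complex.arg_real_mul _ hs', ← Complex.arg_real_mul (cxP q' / cxP p) ht',
    ← mul_div_assoc, ← mul_div_assoc, e]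

lemma angMeasure_eq {p q : Pt} (hp : p ≠ 0) (hq : q ≠ 0) (h : 0 ≤ vdet p q) :
    angMeasure p q = angP p q := by
  have h0 : (0 : ℝ) ≤ (cxP q / cxP p).im := by
    have := angP_nonneg h
    unfold angP at this
    rwa [Complex.arg_nonneg_iff] at this
  unfold angP
  rw [Complex.arg_of_im_nonneg_of_ne_zero h0 (div_ne_zero (cxP_ne hq) (cxP_ne hp)), cxP_re,
    norm_div, Complex.normSq_eq_norm_sq]
  unfold angMeasure
  rw [← cxP_norm, ← cxP_norm]
  have h1 : ‖cxP p‖ ≠ 0 := norm_ne_zero_iff.2 (cxP_ne hp)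
  have h2 : ‖cxP q‖ ≠ 0 := norm_ne_zero_iff.2 (cxP_ne hq)
  congr 1
  field_simp

lemma angMeasure_sgn (i : ℕ) (p q : Pt) :
    angMeasure (sgnAlt i • p) (sgnAlt i • q) = angMeasure p q := by
  unfold sgnAlt
  split_ifs <;> simp [angMeasure]

lemma sail_no_mid {X V Y a b c : Pt} (ha : SailVertex X V Y a) (hb : SailVertex X V Y b)
    (hc : SailVertex X V Y c) (hab : b ≠ a) (hac : c ≠ a) {x y : ℤ} (hx : 0 ≤ x) (hy : 0 ≤ y)
    (hxy : 0 < x + y) (h : (x + y) • (a - V) = x • (b - V) + y • (c - V)) : False := by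
  apply ha.2
  have hs : (0 : ℝ) < (x : ℝ) + y := by exact_mod_cast hxy
  have hx' : (0 : ℝ) ≤ x := by exact_mod_cast hx
  have hy' : (0 : ℝ) ≤ y := by exact_mod_cast hy
  have mb : toR b ∈ convexHull ℝ (toR '' (conePts X V Y \ {a})) :=
    subset_convexHull _ _ ⟨b, ⟨hb.1, hab⟩, rfl⟩
  have mc : toR c ∈ convexHull ℝ (toR '' (conePts X V Y \ {a})) :=
    subset_convexHull _ _ ⟨c, ⟨hc.1, hac⟩, rfl⟩
  have := (convex_convexHull ℝ (toR '' (conePts X V Y \ {a}))) mb mc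
    (div_nonneg hx' hs.le) (div_nonneg hy' hs.le) (by field_simp)
  convert this using 1
  have h1 := congrArg Prod.fst h
  have h2 := congrArg Prod.snd h
  simp at h1 h2
  have h1' : ((x : ℝ) + y) * (a.1 - V.1) = x * (b.1 - V.1) + y * (c.1 - V.1) := by
    exact_mod_cast h1
  have h2' : ((x : ℝ) + y) * (a.2 - V.2) = x * (b.2 - V.2) + y * (c.2 - V.2) := by
    exact_mod_cast h2
  apply Prod.ext
  · simp [toR]; field_simp; linarith
  · simp [toR]; field_simp; linarith

lemma cone_vdet {X V Y P : Pt} (h : 0 < vdet (X - V) (Y - V)) (hP : InAngle X V Y P) :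
    0 ≤ vdet (X - V) (P - V) := by
  obtain ⟨q, s, t, hq, hs, ht, e⟩ := hP
  have h1 := congrArg Prod.fst e
  have h2 := congrArg Prod.snd e
  simp at h1 h2
  have : q * vdet (X - V) (P - V) = t * vdet (X - V) (Y - V) := by
    simp only [vdet, Prod.fst_sub, Prod.snd_sub]
    linear_combination (X.1 - V.1) * h2 - (X.2 - V.2) * h1
  have h3 : 0 ≤ q * vdet (X - V) (P - V) := by rw [this]; positivity
  exact nonneg_of_mul_nonneg_right h3 hq

lemma sail_vdet_pos {X V Y : Pt} {m : ℕ} {B : ℕ → Pt} (h : 0 < vdet (X - V) (Y - V))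
    (hB : IsSailBL X V Y m B) : ∀ j < m, 0 < vdet (B j - V) (B (j + 1) - V) := by
  obtain ⟨hv, -, hinj, ⟨s, t, hs, ht, e⟩, -, hside⟩ := hB
  have key : ∀ j, vdet (B (j + 1) - B j) (V - B j) = vdet (B j - V) (B (j + 1) - V) := by
    intro j
    simp only [vdet, Prod.fst_sub, Prod.snd_sub]
    ring
  intro j
  induction j with
  | zero =>
    intro hj
    have hne := (hside 0 hj).1
    rw [key] at hne
    refine lt_of_le_of_ne ?_ hne.symm
    have h1 := cone_vdet h (hv (0 + 1) hj).1.1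
    have e1 := congrArg Prod.fst e
    have e2 := congrArg Prod.snd e
    simp at e1 e2
    have : s * vdet (B 0 - V) (B (0 + 1) - V) = t * vdet (X - V) (B (0 + 1) - V) := by
      simp only [vdet, Prod.fst_sub, Prod.snd_sub]
      linear_combination ((B (0 + 1)).2 - V.2) * e1 - ((B (0 + 1)).1 - V.1) * e2
    have h3 : 0 ≤ s * vdet (B 0 - V) (B (0 + 1) - V) := by rw [this]; positivity
    exact nonneg_of_mul_nonneg_right h3 hs
  | succ j ih =>
    intro hj
    have hα := ih (by omega)
    have hs1 := (hside j (by omega)).2 _ (hv (j + 1 + 1) hj)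
    have hs2 := (hside (j + 1) hj).2 _ (hv j (by omega))
    have hne := (hside (j + 1) hj).1
    rw [key] at hs1 hs2 hne
    by_contra hcon
    have hβ : vdet (B (j + 1) - V) (B (j + 1 + 1) - V) < 0 := by omega
    have va := hv j (by omega)
    have vb := hv (j + 1) (by omega)
    have vc := hv (j + 1 + 1) (by omega)
    have nab : B (j + 1) ≠ B j := fun hh => by have := hinj _ (by omega) _ (by omega) hh; omega
    have nac : B (j + 1 + 1) ≠ B j := fun hh => by
      have := hinj _ (by omega) _ (by omega) hh; omega
    have nbc : B (j + 1 + 1) ≠ B (j + 1) := fun hh => by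
      have := hinj _ (by omega) _ (by omega) hh; omega
    generalize B j = a at *
    generalize B (j + 1) = b at *
    generalize B (j + 1 + 1) = c at *
    have o1 : vdet (b - a) (c - a) ≤ 0 := by
      by_contra hh
      push Not at hh
      have := mul_pos hα hh
      omega
    have o2 : 0 ≤ vdet (c - b) (a - b) := by
      by_contra hh
      push Not at hh
      have := mul_pos_of_neg_of_neg hβ hh
      omega
    have col : vdet (b - a) (c - a) = 0 := by
      have : vdet (c - b) (a - b) = vdet (b - a) (c - a) := by
        simp only [vdet, Prod.fst_sub, Prod.snd_sub]
        ring
      omega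
    set α := vdet (a - V) (b - V) with hαd
    set β := - vdet (b - V) (c - V) with hβd
    have hβp : 0 < β := by omega
    have I : β • (a - V) = (β - α) • (b - V) + α • (c - V) := by
      simp only [vdet, Prod.fst_sub, Prod.snd_sub] at col hαd hβd
      apply Prod.ext
      · simp
        rw [hαd, hβd]
        linear_combination (b.1 - V.1) * col
      · simp
        rw [hαd, hβd]
        linear_combination (b.2 - V.2) * col
    rcases le_total α β with hle | hle
    · exact sail_no_mid va vb vc nab nac (x := β - α) (y := α) (by omega) (by omega) (by omega)
        (by rw [← I]; congr 1; omega)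
    · refine sail_no_mid vc vb va nbc.symm nac.symm (x := α - β) (y := β) (by omega) (by omega)
        (by omega) ?_
      rw [I]
      module

lemma sail_sum {X V Y : Pt} {m : ℕ} {B : ℕ → Pt} (h : 0 < vdet (X - V) (Y - V))
    (hB : IsSailBL X V Y m B) :
    ∑ j ∈ Finset.range m, angMeasure (B j - V) (B (j + 1) - V) = angP (X - V) (Y - V) := by
  have hpos := sail_vdet_pos h hB
  obtain ⟨hv, -, hinj, ⟨s, t, hs, ht, e⟩, ⟨s', t', hs', ht', e'⟩, hside⟩ := hB
  have hu := vdet_ne_left h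
  have main : ∀ k ≤ m, ∑ j ∈ Finset.range k, angMeasure (B j - V) (B (j + 1) - V)
      = angP (X - V) (B k - V) := by
    intro k
    induction k with
    | zero =>
      intro _
      rw [angP_ray hs ht e, angP_self hu]
      simp
    | succ k ih =>
      intro hk
      have hp := hpos k hk
      rw [Finset.sum_range_succ, ih (by omega),
        angMeasure_eq (vdet_ne_left hp) (vdet_ne_right hp) hp.le,
        angP_add hu (vdet_ne_left hp) (vdet_ne_right hp) (cone_vdet h (hv k (by omega)).1.1) hp.le
          (cone_vdet h (hv (k + 1) (by omega)).1.1) (Or.inr hp)]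
  rw [main m le_rfl, angP_ray hs' ht' e']

lemma polygon_sum (n : ℕ) (hn : 3 ≤ n) (A : ZMod n → Pt) (hA : ConvexPolygon n A) :
    ∑ i ∈ Finset.range n, angP (A ((i : ZMod n) - 1) - A i) (A ((i : ZMod n) + 1) - A i)
      = ((n : ℝ) - 2) * Real.pi := by
  have cast_ne : ∀ a b : ℕ, a < n → b < n → a ≠ b → (a : ZMod n) ≠ b := by
    intro a b ha hb hab h
    rw [ZMod.natCast_eq_natCast_iff'] at h
    rw [Nat.mod_eq_of_lt ha, Nat.mod_eq_of_lt hb] at h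
    exact hab h
  have orient : ∀ a b : ℕ, a + 1 < n → b < n → b ≠ a → b ≠ a + 1 →
      vdet (A ((a + 1 : ℕ) : ZMod n) - A (a : ZMod n)) (A b - A a) < 0 := by
    intro a b ha hb h1 h2
    have := hA a b (cast_ne b a hb (by omega) h1) (by
      have := cast_ne b (a + 1) hb ha h2
      push_cast at this
      exact this)
    push_cast
    exact this
  have main : ∀ k : ℕ, k + 1 < n →
      ∑ i ∈ Finset.range k, angP (A (i : ZMod n) - A ((i + 1 : ℕ) : ZMod n))
          (A ((i + 2 : ℕ) : ZMod n) - A ((i + 1 : ℕ) : ZMod n))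
        + angP (A (k : ZMod n) - A ((k + 1 : ℕ) : ZMod n)) (A ((0 : ℕ) : ZMod n) - A ((k + 1 : ℕ) : ZMod n))
        + angP (A ((k + 1 : ℕ) : ZMod n) - A ((0 : ℕ) : ZMod n)) (A ((1 : ℕ) : ZMod n) - A ((0 : ℕ) : ZMod n))
        = k * Real.pi := by
    intro k
    induction k with
    | zero =>
      intro _
      have h := orient 0 2 (by omega) (by omega) (by omega) (by omega)
      have hne : A ((0 + 1 : ℕ) : ZMod n) - A ((0 : ℕ) : ZMod n) ≠ 0 := by
        intro h0
        rw [h0] at h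
        simp [vdet] at h
      have hne' : A ((0 : ℕ) : ZMod n) - A ((0 + 1 : ℕ) : ZMod n) ≠ 0 := by
        rw [← neg_sub]
        exact neg_ne_zero.2 hne
      rw [angP_self hne']
      have := angP_self hne
      simp only [zero_add] at this ⊢
      rw [this]
      simp
    | succ k ih =>
      intro hk
      have IH := ih (by omega)
      rw [Finset.sum_range_succ]
      -- orientation facts
      have o1 := orient (k + 1) 0 hk (by omega) (by omega) (by omega)
      have o2 := orient (k + 1) k hk (by omega) (by omega) (by omega)
      have o3 : 0 ≤ vdet (A (k : ZMod n) - A ((k + 1 : ℕ) : ZMod n))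
          (A ((0 : ℕ) : ZMod n) - A ((k + 1 : ℕ) : ZMod n)) := by
        rcases Nat.eq_zero_or_pos k with rfl | hk0
        · simp only [vdet]
          apply le_of_eq
          ring
        · have := orient k 0 (by omega) (by omega) (by omega) (by omega)
          simp only [vdet, Prod.fst_sub, Prod.snd_sub] at this ⊢
          linarith
      have o4 := orient 0 (k + 1 + 1) (by omega) (by omega) (by omega) (by omega)
      have o5 : 0 ≤ vdet (A ((k + 1 : ℕ) : ZMod n) - A ((0 : ℕ) : ZMod n))
          (A ((1 : ℕ) : ZMod n) - A ((0 : ℕ) : ZMod n)) := by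
        rcases Nat.eq_zero_or_pos k with rfl | hk0
        · simp only [vdet]
          apply le_of_eq
          ring
        · have := orient 0 (k + 1) (by omega) (by omega) (by omega) (by omega)
          simp only [vdet, zero_add, Prod.fst_sub, Prod.snd_sub] at this ⊢
          linarith
      have ek : k + 2 = k + 1 + 1 := rfl
      rw [ek]
      rw [zero_add] at o4
      have n01 : A ((1 : ℕ) : ZMod n) - A ((0 : ℕ) : ZMod n) ≠ 0 := by
        intro h0
        rw [h0] at o4
        simp [vdet] at o4
      generalize A ((k + 1 + 1 : ℕ) : ZMod n) = R at *
      generalize A ((k + 1 : ℕ) : ZMod n) = Q at *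
      generalize A ((k : ℕ) : ZMod n) = W at *
      generalize A ((0 : ℕ) : ZMod n) = P at *
      generalize A ((1 : ℕ) : ZMod n) = S at *
      have sw : ∀ u v : Pt, vdet u v < 0 → 0 < vdet v u := by
        intro u v h
        simp only [vdet] at h ⊢
        linarith
      have p1 := sw _ _ o1
      have p2 := sw _ _ o2
      have p4 := sw _ _ o4
      have p6 : 0 < vdet (R - P) (Q - P) := by
        simp only [vdet, Prod.fst_sub, Prod.snd_sub] at p1 ⊢
        linarith
      have T := angP_tri p6
      have E1 := angP_add (vdet_ne_left p2) (vdet_ne_left p1) (vdet_ne_right p1) o3 p1.le p2.le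
        (Or.inr p1)
      have E2 := angP_add (vdet_ne_left p6) (vdet_ne_right p6) n01 p6.le o5 p4.le (Or.inl p6)
      rw [E1, E2]
      have : (((k + 1 : ℕ) : ℝ)) * Real.pi = k * Real.pi + Real.pi := by push_cast; ring
      linarith
  obtain ⟨k, rfl⟩ : ∃ k, n = k + 2 := ⟨n - 2, by omega⟩
  have F := main k (by omega)
  have hz : ((k : ZMod (k + 2)) + 2) = 0 := by
    have := ZMod.natCast_self (k + 2)
    push_cast at this
    exact this
  rw [Finset.sum_range_succ', Finset.sum_range_succ]
  have x1 : ∀ i : ℕ, ((i + 1 : ℕ) : ZMod (k + 2)) - 1 = i := by intro i; push_cast; ring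
  have x2 : ∀ i : ℕ, ((i + 1 : ℕ) : ZMod (k + 2)) + 1 = ((i + 2 : ℕ) : ZMod (k + 2)) := by
    intro i; push_cast; ring
  have x3 : ((k + 2 : ℕ) : ZMod (k + 2)) = ((0 : ℕ) : ZMod (k + 2)) := by
    push_cast; exact hz
  have x4 : ((0 : ℕ) : ZMod (k + 2)) - 1 = ((k + 1 : ℕ) : ZMod (k + 2)) := by
    push_cast; linear_combination -hz
  have x5 : ((0 : ℕ) : ZMod (k + 2)) + 1 = ((1 : ℕ) : ZMod (k + 2)) := by
    push_cast; ring
  simp only [x1, x2, x3, x4, x5]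
  rw [F]
  push_cast
  ring

/-- **Proposition.** The winding number about the origin of the sail diagram of
a convex `n`-gon with integer vertices equals `n/2 − 1`. -/
theorem winding_of_sail_diagram (n : ℕ) (hn : 3 ≤ n) (A : ZMod n → Pt)
    (hA : ConvexPolygon n A) (M : ℕ) (D : ℕ → Pt)
    (hD : IsSailDiagram n A M D) :
    winding M D = (n : ℝ) / 2 - 1 := by
  obtain ⟨m, c, B, ⟨hc0, hc, hi⟩, rfl⟩ := hD
  have pos : ∀ i : ZMod n, 0 < vdet (A (i - 1) - A i) (A (i + 1) - A i) := by
    intro i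
    have cast_ne : ∀ a : ℕ, 0 < a → a < n → (a : ZMod n) ≠ 0 := by
      intro a ha hb h
      rw [ZMod.natCast_eq_zero_iff] at h
      exact absurd (Nat.le_of_dvd ha h) (by omega)
    have h1 := cast_ne 1 (by omega) (by omega)
    have h2 := cast_ne 2 (by omega) (by omega)
    push_cast at h1 h2
    have := hA i (i - 1) (fun h => h1 (by linear_combination -h))
      (fun h => h2 (by linear_combination -h))
    simp only [vdet] at this ⊢
    linarith
  have main : ∀ k ≤ n, ∑ i ∈ Finset.range (c k), angMeasure (D i) (D (i + 1)) =
      ∑ i ∈ Finset.range k,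
        angP (A ((i : ZMod n) - 1) - A i) (A ((i : ZMod n) + 1) - A i) := by
    intro k
    induction k with
    | zero => intro _; simp [hc0]
    | succ k ih =>
      intro hk
      obtain ⟨hB, hDk⟩ := hi k hk
      rw [hc, Finset.sum_range_add, ih (by omega), Finset.sum_range_succ,
        ← sail_sum (pos k) hB]
      congr 1
      apply Finset.sum_congr rfl
      intro j hj
      rw [Finset.mem_range] at hj
      rw [hDk j (by omega), add_assoc, hDk (j + 1) (by omega), angMeasure_sgn]
  unfold winding
  rw [main n le_rfl, polygon_sum n hn A hA]
  have := Real.pi_pos.ne'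
  field_simp
end

section
/- Let P be a convex n-gon with integer vertices and angle-curvature sequence S = (α₁,κ₁,…,αₙ,κₙ). Then κ_{n−1} = −⌊K(lls(S₁^{n−1})∘(1)) / K(lls(S₁^{n−1}))⌋. -/
open scoped BigOperators

def stp (p : ℤ × ℤ) (a : ℤ) : ℤ × ℤ := (p.2, a * p.2 + p.1)
def ir (p : ℤ × ℤ) (l : List ℤ) : ℤ × ℤ := l.foldl stp p

theorem ir_append (p : ℤ × ℤ) (l m : List ℤ) : ir p (l ++ m) = ir (ir p l) m := by
  simp [ir]

theorem ir_cons (p : ℤ × ℤ) (a : ℤ) (l : List ℤ) : ir p (a :: l) = ir (stp p a) l := rfl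

theorem ir_rev : ∀ r : List ℤ, (ir (0, 1) r.reverse).2 = contRev r
  | [] => rfl
  | [x] => by simp [ir, stp, contRev]
  | x :: y :: l => by
    have h1 := ir_rev (y :: l)
    have h2 := ir_rev l
    have e : (ir (0, 1) (y :: l).reverse).1 = (ir (0, 1) l.reverse).2 := by
      rw [List.reverse_cons, ir_append]; rfl
    rw [List.reverse_cons, ir_append]
    show x * (ir (0, 1) (y :: l).reverse).2 + (ir (0, 1) (y :: l).reverse).1 = _
    rw [h1, e, h2, contRev]

theorem ir_cont (l : List ℤ) : (ir (0, 1) l).2 = cont l := by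
  have := ir_rev l.reverse
  rwa [List.reverse_reverse] at this

theorem ir_tail (l : List ℤ) (h : l ≠ []) : (ir (1, 0) l).2 = cont l.tail := by
  cases l with
  | nil => exact absurd rfl h
  | cons a t =>
    rw [ir_cons]
    have : stp (1, 0) a = (0, 1) := by simp [stp]
    rw [this, ir_cont]; rfl

theorem cont_append_one (l : List ℤ) :
    cont (l ++ [1]) = (ir (0, 1) l).2 + (ir (0, 1) l).1 := by
  rw [← ir_cont, ir_append]
  simp [ir, stp]

theorem ir_linear (x y x' y' s t : ℤ) (l : List ℤ) :
    ir (s * x + t * x', s * y + t * y') l =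
      (s * (ir (x, y) l).1 + t * (ir (x', y') l).1,
       s * (ir (x, y) l).2 + t * (ir (x', y') l).2) := by
  induction l generalizing x y x' y' with
  | nil => rfl
  | cons a l ih =>
    rw [ir_cons, ir_cons, ir_cons]
    have := ih y (a * y + x) y' (a * y' + x')
    rw [show stp (x, y) a = (y, a * y + x) from rfl,
      show stp (x', y') a = (y', a * y' + x') from rfl, ← this]
    congr 1
    simp only [stp]; ext <;> simp; ring

theorem ir_det (p r : ℤ × ℤ) (l : List ℤ) :
    (ir p l).1 * (ir r l).2 - (ir r l).1 * (ir p l).2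
      = (-1) ^ l.length * (p.1 * r.2 - r.1 * p.2) := by
  induction l generalizing p r with
  | nil => simp [ir]
  | cons a l ih =>
    rw [ir_cons, ir_cons, ih, List.length_cons]
    simp only [stp]; ring

theorem ir_pos (l : List ℤ) (hl : ∀ x ∈ l, 0 < x) (p r : ℤ × ℤ)
    (h : 0 ≤ p.1 ∧ p.1 ≤ r.1 ∧ 0 < p.2 ∧ p.2 ≤ r.2 ∧ 0 < r.1 ∧ r.1 ≤ r.2) :
    0 ≤ (ir p l).1 ∧ (ir p l).1 ≤ (ir r l).1 ∧ 0 < (ir p l).2 ∧ (ir p l).2 ≤ (ir r l).2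
      ∧ 0 < (ir r l).1 ∧ (ir r l).1 ≤ (ir r l).2 := by
  induction l generalizing p r with
  | nil => exact h
  | cons a l ih =>
    rw [ir_cons, ir_cons]
    have ha : 0 < a := hl a (by simp)
    apply ih (fun x hx => hl x (by simp [hx]))
    obtain ⟨h1, h2, h3, h4, h5, h6⟩ := h
    simp only [stp]
    refine ⟨by omega, h4, by nlinarith, by nlinarith, by omega, by nlinarith⟩

/-- numeric facts for a valid list -/
structure LNum (c1 d1 c2 d2 : ℤ) : Prop where
  hd1 : 0 < d1
  hd12 : d1 ≤ d2
  hc2 : 0 < c2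
  hc2d2 : c2 ≤ d2
  hdet : c2 * d1 - d2 * c1 = 1

theorem num_of (l : List ℤ) (h : ValidLLS l) :
    LNum (ir (1, 0) l).1 (ir (0, 1) l).1 (ir (1, 0) l).2 (ir (0, 1) l).2 := by
  obtain ⟨ho, hp⟩ := h
  have hdet := ir_det (1, 0) (0, 1) l
  rw [Odd.neg_one_pow (Nat.odd_iff.2 ho)] at hdet
  cases l with
  | nil => simp at ho
  | cons a t =>
    have ha : 0 < a := hp a (by simp)
    have := ir_pos t (fun x hx => hp x (by simp [hx])) (stp (1, 0) a) (stp (0, 1) a)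
      (by simp [stp]; omega)
    obtain ⟨h1, h2, h3, h4, h5, h6⟩ := this
    rw [← ir_cons, ← ir_cons] at *
    exact ⟨h5, h6, h3, h4, by simp at hdet; linarith⟩

theorem prim_mul (p r w : Pt) (s t : ℤ) (hr : vdet p r = 1) (hs : 0 < s) (ht : 0 < t)
    (h : s • p = t • w) : ∃ k : ℤ, 0 < k ∧ w = k • p := by
  obtain ⟨p1, p2⟩ := p
  obtain ⟨r1, r2⟩ := r
  obtain ⟨w1, w2⟩ := w
  simp only [vdet, Prod.smul_mk, smul_eq_mul, Prod.mk.injEq] at *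
  obtain ⟨h1, h2⟩ := h
  have h0 : p1 * w2 - p2 * w1 = 0 := by
    have : t * (p1 * w2 - p2 * w1) = 0 := by linear_combination p2 * h1 - p1 * h2
    rcases mul_eq_zero.1 this with h | h <;> omega
  have hk : t * (w1 * r2 - w2 * r1) = s := by
    linear_combination s * hr - r2 * h1 + r1 * h2
  refine ⟨w1 * r2 - w2 * r1, by by_contra hh; nlinarith, ?_, ?_⟩
  · linear_combination -w1 * hr + r1 * h0
  · linear_combination -w2 * hr + r2 * h0

theorem il_of (V Y p r : Pt) (k : ℤ) (hk : 0 ≤ k) (hr : vdet p r = 1) (h : Y - V = k • p) :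
    il V Y = k := by
  obtain ⟨p1, p2⟩ := p
  obtain ⟨r1, r2⟩ := r
  obtain ⟨v1, v2⟩ := V
  obtain ⟨y1, y2⟩ := Y
  simp only [vdet, Prod.smul_mk, smul_eq_mul, Prod.mk_sub_mk, Prod.mk.injEq] at *
  have hg : Int.gcd p1 p2 = 1 :=
    Int.isCoprime_iff_gcd_eq_one.1 ⟨r2, -r1, by linarith⟩
  rw [il]
  simp only
  rw [h.1, h.2, Int.gcd_mul_left, hg]
  simp [abs_of_nonneg hk]

theorem il_symm (P Q : Pt) : il P Q = il Q P := by
  simp only [il]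
  rw [← neg_sub P.1 Q.1, ← neg_sub P.2 Q.2, Int.gcd_neg, Int.neg_gcd]

theorem idist_of (P V Y p r : Pt) (k : ℤ) (hk : 0 < k) (hr : vdet p r = 1) (h : Y - V = k • p) :
    idist P V Y = |vdet p (P - V)| := by
  rw [idist, il_of V Y p r k hk.le hr h, h]
  have : vdet (k • p) (P - V) = k * vdet p (P - V) := by
    simp [vdet]; ring
  rw [this, abs_mul, abs_of_pos hk, Int.mul_ediv_cancel_left _ hk.ne']

theorem idist_of2 (P V X p r : Pt) (k : ℤ) (hk : 0 < k) (hr : vdet p r = 1) (h : X - V = k • p) :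
    idist P X V = |vdet p (P - V)| := by
  rw [← idist_of P V X p r k hk hr h, idist, idist, il_symm X V]
  congr 1
  rw [← abs_neg]
  congr 1
  simp [vdet]; ring

structure Fr (X V Y : Pt) (l : List ℤ) (e q : Pt) : Prop where
  hq : vdet e q = 1
  hx : ∃ k : ℤ, 0 < k ∧ X - V = k • e
  hy : ∃ k : ℤ, 0 < k ∧ Y - V = k • ((ir (1, 0) l).2 • e + (ir (0, 1) l).2 • q)
  hl : ValidLLS l

theorem fr_exists (X V Y : Pt) (l : List ℤ) (h : IsLLSOfAngle X V Y l)
    (ho : 0 < vdet (X - V) (Y - V)) : ∃ e q, Fr X V Y l e q := by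
  obtain ⟨hv, T, h0, ⟨s, t, hs, ht, h1⟩, ⟨s', t', hs', ht', h2⟩⟩ := h
  have N := num_of l hv
  have hne : l ≠ [] := by rintro rfl; simp [ValidLLS] at hv
  rw [stdPt, ← ir_tail l hne, ← ir_cont] at h2
  generalize hc1 : (ir (1, 0) l).1 = c1 at *
  generalize hc2 : (ir (1, 0) l).2 = c2 at *
  generalize hd1 : (ir (0, 1) l).1 = d1 at *
  generalize hd2 : (ir (0, 1) l).2 = d2 at *
  obtain ⟨a, b, c, d, u, v, hu⟩ := T
  have e1 : (IntAff.apply ⟨a, b, c, d, u, v, hu⟩ (1, 0)) - V = (a, c) := by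
    rw [← h0]; simp [IntAff.apply]
  have e2 : (IntAff.apply ⟨a, b, c, d, u, v, hu⟩ (c2, d2)) - V
      = c2 • ((a, c) : Pt) + d2 • ((b, d) : Pt) := by
    rw [← h0]; simp [IntAff.apply]; constructor <;> ring
  rw [e1] at h1
  rw [e2] at h2
  set ε := a * d - b * c with hε
  have hεε : ε * ε = 1 := by rcases hu with h | h <;> rw [h] <;> norm_num
  obtain ⟨k, hk, hX⟩ := prim_mul (a, c) (ε * b, ε * d) (X - V) s t
    (by simp only [vdet]; linear_combination hεε) hs ht h1
  obtain ⟨k', hk', hY⟩ := prim_mul (c2 • ((a, c) : Pt) + d2 • ((b, d) : Pt))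
    (ε • (c1 • ((a, c) : Pt) + d1 • ((b, d) : Pt))) (Y - V) s' t'
    (by simp [vdet]; linear_combination hεε + ε * ε * N.hdet) hs' ht' h2
  refine ⟨(a, c), (b, d), ?_, ⟨k, hk, hX⟩, ⟨k', hk', ?_⟩, hv⟩
  · rw [hX, hY] at ho
    have e3 : vdet (k • ((a, c) : Pt)) (k' • (c2 • ((a, c) : Pt) + d2 • ((b, d) : Pt)))
      = (k * k' * d2) * ε := by simp [vdet]; rw [hε]; ring
    rw [e3] at ho
    have hp : 0 < k * k' * d2 := by
      have := N.hd1; have := N.hd12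
      have : 0 < d2 := by omega
      positivity
    have : 0 < ε := by by_contra hh; nlinarith
    have : ε = 1 := by omega
    simp only [vdet]; linarith
  · rw [hc2, hd2]; exact hY

theorem near1 (X V Y P : Pt) (l : List ℤ) (e q : Pt) (F : Fr X V Y l e q)
    (h : IsNearPt X V Y P) :
    P - V = ((ir (1, 0) l).2 - (ir (1, 0) l).1) • e + ((ir (0, 1) l).2 - (ir (0, 1) l).1) • q := by
  obtain ⟨hq, ⟨k, hk, hX⟩, ⟨k', hk', hY⟩, hv⟩ := F
  have N := num_of l hv
  generalize (ir (1, 0) l).1 = c1 at *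
  generalize (ir (1, 0) l).2 = c2 at *
  generalize (ir (0, 1) l).1 = d1 at *
  generalize (ir (0, 1) l).2 = d2 at *
  obtain ⟨n1, n2, n3, n4, n5⟩ := N
  obtain ⟨hin, hd, hmin⟩ := h
  have hf : vdet (c2 • e + d2 • q) (c1 • e + d1 • q) = 1 := by
    have : vdet (c2 • e + d2 • q) (c1 • e + d1 • q) = (c2 * d1 - d2 * c1) * vdet e q := by
      simp [vdet]; ring
    rw [this, hq, n5]; rfl
  have D1 := fun P => idist_of P V Y _ _ k' hk' hf hY
  have D2 := fun P => idist_of2 P V X _ _ k hk hq hX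
  simp only [D1, D2] at hd hmin
  have hQ := hmin (V + ((c2 - c1) • e + (d2 - d1) • q)) (by
      refine ⟨k * k' * d2, k', k * (d2 - d1), ?_, hk'.le, ?_, ?_⟩
      · have : 0 < d2 := by omega
        positivity
      · have : 0 ≤ d2 - d1 := by omega
        positivity
      · rw [hX, hY, add_sub_cancel_left]
        ext
        · simp; linear_combination k * k' * e.1 * n5
        · simp; linear_combination k * k' * e.2 * n5) (by
      rw [add_sub_cancel_left]
      have : vdet (c2 • e + d2 • q) ((c2 - c1) • e + (d2 - d1) • q)
        = -(c2 * d1 - d2 * c1) * vdet e q := by simp [vdet]; ring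
      rw [this, n5, hq]; simp)
  rw [add_sub_cancel_left] at hQ
  obtain ⟨m, s, t, hm, hs, ht, hin⟩ := hin
  rw [hX, hY] at hin
  generalize P - V = p at *
  obtain ⟨e1, e2⟩ := e
  obtain ⟨q1, q2⟩ := q
  obtain ⟨p1, p2⟩ := p
  simp only [vdet, Prod.smul_mk, smul_eq_mul, Prod.mk_add_mk, Prod.mk.injEq] at *
  obtain ⟨i1, i2⟩ := hin
  have hd2 : 0 < d2 := by omega
  set y := e1 * p2 - e2 * p1 with hy
  set x := p1 * q2 - p2 * q1 with hx
  have hp1 : p1 = x * e1 + y * q1 := by rw [hx, hy]; linear_combination -p1 * hq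
  have hp2 : p2 = x * e2 + y * q2 := by rw [hx, hy]; linear_combination -p2 * hq
  have hmy : m * y = t * k' * d2 := by
    rw [hy]; linear_combination e1 * i2 - e2 * i1 + t * k' * d2 * hq
  have hmx : m * x = s * k + t * k' * c2 := by
    rw [hx]; linear_combination q2 * i1 - q1 * i2 + (s * k + t * k' * c2) * hq
  have hy0 : 0 ≤ y := by
    have : 0 ≤ t * k' * d2 := by positivity
    by_contra hh; nlinarith
  have hz0 : 0 ≤ x * d2 - y * c2 := by
    have h1 : m * (x * d2 - y * c2) = s * k * d2 := by linear_combination d2 * hmx - c2 * hmy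
    have : 0 ≤ s * k * d2 := by positivity
    by_contra hh; nlinarith
  have hz : x * d2 - y * c2 = 1 := by
    have : (c2 * e1 + d2 * q1) * p2 - (c2 * e2 + d2 * q2) * p1 = -(x * d2 - y * c2) := by
      rw [hp1, hp2]; linear_combination (c2 * y - d2 * x) * hq
    rw [this, abs_neg, abs_of_nonneg hz0] at hd
    exact hd
  have hyle : y ≤ d2 - d1 := by
    have : e1 * ((c2 - c1) * e2 + (d2 - d1) * q2) - e2 * ((c2 - c1) * e1 + (d2 - d1) * q1)
      = d2 - d1 := by linear_combination (d2 - d1) * hq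
    rw [this, abs_of_nonneg hy0, abs_of_nonneg (by omega)] at hQ
    exact hQ
  -- y = d2 - d1 + j d2
  have hj : y - (d2 - d1) = d2 * (x * d1 - y * c1 - 1) := by
    linear_combination -d1 * hz - y * n5
  have hj0 : x * d1 - y * c1 - 1 = 0 := by
    generalize x * d1 - y * c1 - 1 = j at *
    have : j < 1 := by by_contra hh; nlinarith
    have : -1 < j := by by_contra hh; nlinarith
    omega
  rw [hj0] at hj
  have hyy : y = d2 - d1 := by linarith
  have hxx : x = c2 - c1 := by
    have : d2 * (x - (c2 - c1)) = 0 := by rw [hyy] at hz; linear_combination hz - n5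
    rcases mul_eq_zero.1 this with h | h <;> omega
  rw [hp1, hp2, hyy, hxx]
  exact ⟨rfl, rfl⟩

theorem near2 (X V Y P : Pt) (l : List ℤ) (e q : Pt) (F : Fr X V Y l e q)
    (h : IsNearPt Y V X P) : P - V = e + q := by
  obtain ⟨hq, ⟨k, hk, hX⟩, ⟨k', hk', hY⟩, hv⟩ := F
  have N := num_of l hv
  generalize (ir (1, 0) l).1 = c1 at *
  generalize (ir (1, 0) l).2 = c2 at *
  generalize (ir (0, 1) l).1 = d1 at *
  generalize (ir (0, 1) l).2 = d2 at *
  obtain ⟨n1, n2, n3, n4, n5⟩ := N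
  obtain ⟨hin, hd, hmin⟩ := h
  have hf : vdet (c2 • e + d2 • q) (c1 • e + d1 • q) = 1 := by
    have : vdet (c2 • e + d2 • q) (c1 • e + d1 • q) = (c2 * d1 - d2 * c1) * vdet e q := by
      simp [vdet]; ring
    rw [this, hq, n5]; rfl
  have D1 := fun P => idist_of2 P V Y _ _ k' hk' hf hY
  have D2 := fun P => idist_of P V X _ _ k hk hq hX
  simp only [D1, D2] at hd hmin
  have hQ := hmin (V + (e + q)) (by
      refine ⟨k * k' * d2, k, k' * (d2 - c2), ?_, hk.le, ?_, ?_⟩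
      · have : 0 < d2 := by omega
        positivity
      · have : 0 ≤ d2 - c2 := by omega
        positivity
      · rw [hX, hY, add_sub_cancel_left]
        ext <;> simp <;> ring) (by
      rw [add_sub_cancel_left]
      have : vdet e (e + q) = vdet e q := by simp [vdet]; ring
      rw [this, hq]; simp)
  rw [add_sub_cancel_left] at hQ
  obtain ⟨m, t, s, hm, ht, hs, hin⟩ := hin
  rw [hX, hY] at hin
  generalize P - V = p at *
  obtain ⟨e1, e2⟩ := e
  obtain ⟨q1, q2⟩ := q
  obtain ⟨p1, p2⟩ := p
  simp only [vdet, Prod.smul_mk, smul_eq_mul, Prod.mk_add_mk, Prod.mk.injEq] at *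
  obtain ⟨i1, i2⟩ := hin
  have hd2 : 0 < d2 := by omega
  set y := e1 * p2 - e2 * p1 with hy
  set x := p1 * q2 - p2 * q1 with hx
  have hp1 : p1 = x * e1 + y * q1 := by rw [hx, hy]; linear_combination -p1 * hq
  have hp2 : p2 = x * e2 + y * q2 := by rw [hx, hy]; linear_combination -p2 * hq
  have hmy : m * y = t * k' * d2 := by
    rw [hy]; linear_combination e1 * i2 - e2 * i1 + t * k' * d2 * hq
  have hmx : m * x = s * k + t * k' * c2 := by
    rw [hx]; linear_combination q2 * i1 - q1 * i2 + (s * k + t * k' * c2) * hq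
  have hy0 : 0 ≤ y := by
    have : 0 ≤ t * k' * d2 := by positivity
    by_contra hh; nlinarith
  have hz0 : 0 ≤ x * d2 - y * c2 := by
    have h1 : m * (x * d2 - y * c2) = s * k * d2 := by linear_combination d2 * hmx - c2 * hmy
    have : 0 ≤ s * k * d2 := by positivity
    by_contra hh; nlinarith
  have hy1 : y = 1 := by rw [abs_of_nonneg hy0] at hd; exact hd
  have hzle : x * d2 - y * c2 ≤ d2 - c2 := by
    have h1 : (c2 * e1 + d2 * q1) * p2 - (c2 * e2 + d2 * q2) * p1 = -(x * d2 - y * c2) := by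
      rw [hp1, hp2]; linear_combination (c2 * y - d2 * x) * hq
    have h2 : (c2 * e1 + d2 * q1) * (e2 + q2) - (c2 * e2 + d2 * q2) * (e1 + q1)
      = -(d2 - c2) := by linear_combination (c2 - d2) * hq
    rw [h1, h2, abs_neg, abs_neg, abs_of_nonneg hz0, abs_of_nonneg (by omega)] at hQ
    exact hQ
  rw [hy1] at hz0 hzle
  have hx1 : x = 1 := by
    have : x < 2 := by by_contra hh; nlinarith
    have : 0 < x := by by_contra hh; nlinarith
    omega
  rw [hp1, hp2, hy1, hx1]
  constructor <;> ring

theorem prim_unique (p r p' r' w : Pt) (k k' : ℤ) (hr : vdet p r = 1) (hr' : vdet p' r' = 1)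
    (hk : 0 < k) (hk' : 0 < k') (h : w = k • p) (h' : -w = k' • p') : p' = -p := by
  have h0 : il 0 w = k := il_of 0 w p r k hk.le hr (by simpa using h)
  have h0' : il w 0 = k' := il_of w 0 p' r' k' hk'.le hr' (by simpa using h')
  rw [il_symm, h0] at h0'
  subst h0'
  rw [h] at h'
  have := smul_right_injective Pt hk.ne' (a₁ := -p) (a₂ := p') (by simpa using h')
  exact this.symm

theorem sgn_il (f r B C : Pt) (u : Pt) (k s : ℤ) (hk : 0 < k) (hr : vdet f r = 1)
    (hu : u = k • f) (h : C - B = s • f) : sgnDir u (C - B) * il B C = s := by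
  have hf : f ≠ 0 := by rintro rfl; simp [vdet] at hr
  rcases lt_trichotomy s 0 with hs | hs | hs
  · have h1 : il B C = -s := by
      rw [il_symm]
      apply il_of C B f r (-s) (by omega) hr
      rw [neg_smul, ← h, neg_sub]
    have h2 : sgnDir u (C - B) = -1 := by
      rw [sgnDir, if_neg, if_neg]
      · rintro ⟨a, b, ha, hb, hab⟩
        rw [h, hu, smul_smul, smul_smul] at hab
        have := smul_left_injective ℤ hf hab
        nlinarith [mul_pos hb hk]
      · rw [h]
        exact smul_ne_zero hs.ne hf
    rw [h1, h2]; ring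
  · subst hs
    rw [h, sgnDir, if_pos (by rw [zero_smul]; rfl), zero_mul]
  · have h1 : il B C = s := il_of B C f r s hs.le hr h
    have h2 : sgnDir u (C - B) = 1 := by
      rw [sgnDir, if_neg, if_pos]
      · exact ⟨k, s, hk, hs, by rw [h, hu, smul_comm]⟩
      · rw [h]
        exact smul_ne_zero hs.ne' hf
    rw [h1, h2]; ring

theorem fr_hf {X V Y : Pt} {l : List ℤ} {e q : Pt} (F : Fr X V Y l e q) :
    vdet ((ir (1, 0) l).2 • e + (ir (0, 1) l).2 • q)
      ((ir (1, 0) l).1 • e + (ir (0, 1) l).1 • q) = 1 := by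
  have N := num_of l F.hl
  have hq := F.hq
  generalize (ir (1, 0) l).1 = c1 at *
  generalize (ir (1, 0) l).2 = c2 at *
  generalize (ir (0, 1) l).1 = d1 at *
  generalize (ir (0, 1) l).2 = d2 at *
  have : vdet (c2 • e + d2 • q) (c1 • e + d1 • q) = (c2 * d1 - d2 * c1) * vdet e q := by
    simp [vdet]; ring
  rw [this, hq, N.hdet]; rfl

theorem link (A B C D : Pt) (l l' : List ℤ) (e q e' q' : Pt) (κ : ℤ)
    (F : Fr A B C l e q) (F' : Fr B C D l' e' q') (h : IsChordCurv A B C D κ) :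
    e' = -((ir (1, 0) l).2 • e + (ir (0, 1) l).2 • q) ∧
    q' = -((ir (1, 0) l).1 • e + (ir (0, 1) l).1 • q)
      - κ • ((ir (1, 0) l).2 • e + (ir (0, 1) l).2 • q) := by
  obtain ⟨B', C', hB, hC, hκ⟩ := h
  have hB := near1 _ _ _ _ _ _ _ F hB
  have hC := near2 _ _ _ _ _ _ _ F' hC
  have hf := fr_hf F
  rw [sub_smul, sub_smul, sub_add_sub_comm] at hB
  obtain ⟨k, hk, hY⟩ := F.hy
  obtain ⟨k', hk', hX⟩ := F'.hx
  have hq' := F'.hq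
  generalize (ir (1, 0) l).2 • e + (ir (0, 1) l).2 • q = f at *
  generalize (ir (1, 0) l).1 • e + (ir (0, 1) l).1 • q = g at *
  have he : e' = -f := prim_unique f g e' q' (C - B) k k' hf hq' hk hk' hY (by rw [← hX, neg_sub])
  refine ⟨he, ?_⟩
  obtain ⟨w, hw⟩ : ∃ w : ℤ, q' + g = w • f := by
    subst he
    refine ⟨vdet (q' + g) g, ?_⟩
    obtain ⟨f1, f2⟩ := f
    obtain ⟨g1, g2⟩ := g
    obtain ⟨q1, q2⟩ := q'
    simp [vdet] at *
    have h0 : f1 * (q2 + g2) - f2 * (q1 + g1) = 0 := by linear_combination hf - hq'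
    constructor
    · linear_combination -(q1 + g1) * hf + g1 * h0
    · linear_combination -(q2 + g2) * hf + g2 * h0
  have hs : C' - B' = (k - 2 + w) • f := by
    have : C' - B' = (C' - C) + (C - B) - (B' - B) := by abel
    rw [this, hC, hB, hY, he, add_smul, ← hw, sub_smul, two_smul]
    abel
  rw [sgn_il f g B' C' (C - B) k _ hk hf hY hs, il_of B C f g k hk.le hf hY] at hκ
  have : κ = -w := by rw [hκ]; ring
  rw [this, neg_smul, ← hw]; abel

theorem final_floor (c1 d1 c2 d2 κ a b σ : ℤ) (N : LNum c1 d1 c2 d2) (hσ : σ = 1 ∨ σ = -1)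
    (ha : a = σ * (c2 + κ * d2)) (hb : b = σ * (-d2)) :
    κ = -⌊((b + a : ℤ) : ℚ) / (b : ℚ)⌋ := by
  have hd2 : (0 : ℚ) < d2 := by
    have := N.hd1; have := N.hd12
    exact_mod_cast (by omega : 0 < d2)
  have hc : (0 : ℚ) < c2 := by exact_mod_cast N.hc2
  have hcd : (c2 : ℚ) ≤ d2 := by exact_mod_cast N.hc2d2
  have : ((b + a : ℤ) : ℚ) / (b : ℚ) = 1 - κ - c2 / d2 := by
    rcases hσ with rfl | rfl <;> subst ha <;> subst hb <;> push_cast <;> field_simp <;> ring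
  rw [this, eq_neg_iff_add_eq_zero, add_comm, ← eq_neg_iff_add_eq_zero, Int.floor_eq_iff]
  have h1 : (c2 : ℚ) / d2 ≤ 1 := (div_le_one hd2).2 hcd
  have h2 : 0 < (c2 : ℚ) / d2 := div_pos hc hd2
  push_cast
  constructor <;> linarith

/-- **Corollary.** Let `P` be a convex `n`-gon with integer vertices and
angle-curvature sequence `S = (α₁,κ₁,…,αₙ,κₙ)`. Then
`κ_{n−1} = −⌊K(lls(S₁^{n−1})∘(1)) / K(lls(S₁^{n−1}))⌋`
(0-indexed: `κ (n-2)`, and `lls(S₁^{n−1}) = llsCat L κ 0 (n-2)`). -/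
theorem curvature_formula (n : ℕ) (hn : 3 ≤ n) (A : ZMod n → Pt)
    (hA : ConvexPolygon n A) (L : ℕ → List ℤ) (κ : ℕ → ℤ)
    (hacs : HasACS n A L κ) :
    κ (n - 2) =
      -⌊(cont (llsCat L κ 0 (n - 2) ++ [1]) : ℚ) / (cont (llsCat L κ 0 (n - 2)) : ℚ)⌋ := by
  haveI : Fact (1 < n) := ⟨by omega⟩
  have h2 : (2 : ZMod n) ≠ 0 := by
    intro h
    have := (ZMod.natCast_eq_zero_iff 2 n).1 (by exact_mod_cast h)
    have := Nat.le_of_dvd (by norm_num) this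
    omega
  have hor : ∀ i : ZMod n, 0 < vdet (A (i - 1) - A i) (A (i + 1) - A i) := by
    intro i
    have := hA i (i - 1) (by simp) (by
      intro h
      apply h2
      linear_combination -h)
    simp only [vdet] at *
    linarith
  have hF : ∀ i : ℕ, ∃ e q, i < n →
      Fr (A ((i : ZMod n) - 1)) (A (i : ZMod n)) (A ((i : ZMod n) + 1)) (L i) e q := by
    intro i
    by_cases hi : i < n
    · obtain ⟨e, q, h⟩ := fr_exists _ _ _ _ (hacs i hi).1 (hor i)
      exact ⟨e, q, fun _ => h⟩
    · exact ⟨0, 0, fun h => absurd h hi⟩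
  choose e q F using hF
  have hlink : ∀ i : ℕ, i + 1 < n →
      e (i + 1) = -((ir (1, 0) (L i)).2 • e i + (ir (0, 1) (L i)).2 • q i) ∧
      q (i + 1) = -((ir (1, 0) (L i)).1 • e i + (ir (0, 1) (L i)).1 • q i)
        - κ i • ((ir (1, 0) (L i)).2 • e i + (ir (0, 1) (L i)).2 • q i) := by
    intro i hi
    have F1 := F (i + 1) hi
    have c1 : (((i + 1 : ℕ) : ZMod n)) - 1 = i := by push_cast; ring
    have c2 : (((i + 1 : ℕ) : ZMod n)) + 1 = i + 2 := by push_cast; ring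
    have c3 : (((i + 1 : ℕ) : ZMod n)) = i + 1 := by push_cast; ring
    rw [c1, c2, c3] at F1
    exact link _ _ _ _ _ _ _ _ _ _ _ (F i (by omega)) F1 (hacs i (by omega)).2
  -- run from the first frame, one coordinate functional at a time
  have hrun : ∀ φ : Pt →+ ℤ, ∀ m : ℕ, m < n →
      ir (φ (e 0), φ (q 0)) (llsCat L κ 0 m) =
        ((-1) ^ m * φ ((ir (1, 0) (L m)).1 • e m + (ir (0, 1) (L m)).1 • q m),
         (-1) ^ m * φ ((ir (1, 0) (L m)).2 • e m + (ir (0, 1) (L m)).2 • q m)) := by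
    intro φ m
    have key : ∀ (x y σ : ℤ) (l : List ℤ), ir (σ * x, σ * y) l =
        (σ * ((ir (1, 0) l).1 * x + (ir (0, 1) l).1 * y),
         σ * ((ir (1, 0) l).2 * x + (ir (0, 1) l).2 * y)) := by
      intro x y σ l
      have := ir_linear 1 0 0 1 (σ * x) (σ * y) l
      simp only [mul_one, mul_zero, add_zero, zero_add] at this
      rw [this]
      ext <;> simp <;> ring
    induction m with
    | zero =>
      intro _
      have := key (φ (e 0)) (φ (q 0)) 1 (L 0)
      simp only [one_mul] at this
      simp only [llsCat, this, pow_zero, one_mul, map_add, map_zsmul, smul_eq_mul]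
    | succ m ih =>
      intro hm
      obtain ⟨he, hq⟩ := hlink m hm
      have ih := ih (by omega)
      rw [llsCat, zero_add, ir_append, ih, ir_cons]
      have hst : stp ((-1) ^ m * φ ((ir (1, 0) (L m)).1 • e m + (ir (0, 1) (L m)).1 • q m),
         (-1) ^ m * φ ((ir (1, 0) (L m)).2 • e m + (ir (0, 1) (L m)).2 • q m)) (κ m)
         = ((-1) ^ (m + 1) * φ (e (m + 1)), (-1) ^ (m + 1) * φ (q (m + 1))) := by
        rw [he, hq]
        simp only [stp, map_neg, map_sub, map_zsmul, smul_eq_mul]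
        ext <;> simp only [] <;> ring
      rw [hst, key]
      simp only [map_add, map_zsmul, smul_eq_mul]
  -- last frame
  obtain ⟨N, rfl⟩ : ∃ N, n = N + 2 := ⟨n - 2, by omega⟩
  simp only [Nat.add_sub_cancel]
  have Fl := F (N + 1) (by omega)
  have F0 := F 0 (by omega)
  have cN : (((N + 1 : ℕ) : ZMod (N + 2))) = -1 := by
    have : ((N + 2 : ℕ) : ZMod (N + 2)) = 0 := ZMod.natCast_self _
    push_cast at this ⊢
    linear_combination this
  rw [cN] at Fl
  simp only [Nat.cast_zero, zero_sub, zero_add, neg_add_cancel] at F0 Fl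
  obtain ⟨k, hk, hx⟩ := F0.hx
  obtain ⟨k', hk', hy⟩ := Fl.hy
  have he0 := prim_unique _ _ _ _ (A 0 - A (-1)) k' k (fr_hf Fl) F0.hq hk' hk hy
    (by rw [← hx, neg_sub])
  have hr := hrun
    { toFun := fun w => vdet (e 0) w
      map_zero' := by simp [vdet]
      map_add' := by intro x y; simp [vdet]; ring } N (by omega)
  have h00 : vdet (e 0) (e 0) = 0 := by simp [vdet]; ring
  simp only [AddMonoidHom.coe_mk, ZeroHom.coe_mk, h00, F0.hq] at hr
  obtain ⟨hl1, hl2⟩ := hlink N (by omega)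
  have hql := Fl.hq
  rw [cont_append_one, ← ir_cont, hr]
  have e1 : (ir (1, 0) (L N)).2 • e N + (ir (0, 1) (L N)).2 • q N = - e (N + 1) := by
    rw [hl1, neg_neg]
  rw [e1] at hl2 ⊢
  have e2 : (ir (1, 0) (L N)).1 • e N + (ir (0, 1) (L N)).1 • q N
      = κ N • e (N + 1) - q (N + 1) := by
    rw [hl2, smul_neg]; abel
  rw [e2, he0]
  refine final_floor _ _ _ _ (κ N) _ _ ((-1) ^ N) (num_of _ Fl.hl) (neg_one_pow_eq_or ℤ N) ?_ ?_
  · congr 1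
    simp [vdet] at hql ⊢
    linear_combination ((ir (1, 0) (L (N + 1))).2 + κ N * (ir (0, 1) (L (N + 1))).2) * hql
  · congr 1
    simp [vdet] at hql ⊢
    linear_combination (-1) ^ N * (-(ir (0, 1) (L (N + 1))).2) * hql
end
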